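/- arXiv:1705.03804 — 2 statements merged into one kernel-verified Lean document; each statement's English description precedes it below -/
import Mathlib

section
/- For every integer n ≥ 1, the number of symplectic Dellac configurations of size 2n equals r_n; equivalently, 2^n · #SpDC_{2n} = D_n(1), where D_n is the n-th Randrianarivony–Zeng polynomial. -/
/-- A Dellac configuration of size `m`: a set of dots `(j, i)` with `j ∈ [1, m]`,
`i ∈ [1, 2m]`, each row containing exactly one dot, each column exactly two dots,
and each dot satisfying `j ≤ i ≤ j + m`. -/
def IsDellac (m : ℕ) (D : Finset (ℕ × ℕ)) : Prop :=
  (∀ d ∈ D, 1 ≤ d.1 ∧ d.1 ≤ m ∧ 1 ≤ d.2 ∧ d.2 ≤ 2 * m) ∧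
  (∀ i, 1 ≤ i → i ≤ 2 * m → (D.filter (fun d => d.2 = i)).card = 1) ∧
  (∀ j, 1 ≤ j → j ≤ m → (D.filter (fun d => d.1 = j)).card = 2) ∧
  (∀ d ∈ D, d.1 ≤ d.2 ∧ d.2 ≤ d.1 + m)

/-- A symplectic Dellac configuration of size `2n`: a Dellac configuration of size `2n`
which is invariant under the central reflection `(j, i) ↦ (2n+1-j, 4n+1-i)`. -/
def IsSpDC (n : ℕ) (S : Finset (ℕ × ℕ)) : Prop :=
  IsDellac (2 * n) S ∧
  ∀ j i, 1 ≤ j → j ≤ 2 * n → 1 ≤ i → i ≤ 4 * n →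
    ((j, i) ∈ S ↔ (2 * n + 1 - j, 4 * n + 1 - i) ∈ S)

/-- The set of symplectic Dellac configurations of size `2n`. -/
def SpDC (n : ℕ) : Set (Finset (ℕ × ℕ)) := {S | IsSpDC n S}

/-- The Randrianarivony–Zeng polynomials, as integer-valued functions:
`D_0(x) = 1` and `D_{n+1}(x) = (x+1)(x+2) D_n(x+2) - x(x+1) D_n(x)`. -/
def RZ : ℕ → ℤ → ℤ
  | 0, _ => 1
  | n + 1, x => (x + 1) * (x + 2) * RZ n (x + 2) - x * (x + 1) * RZ n x

/-- The raising step on test functions dual to `(N + 1) P_{N+1} = (N + 1) X P_N + (X² - 1) dP_N/dX`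
for Legendre polynomials, where `N = c + 1`. -/
def legendreRaise (c : ℕ) (Q : ℤ → ℚ) (x : ℤ) : ℚ :=
  (((x : ℚ) + 2) * Q (x + 2) - (x - c) * Q x) / (c + 2)

/-- The functional `Q ↦ ∑ φ_i Q(2 i + 1)`, where `φ_i` is the coefficient of `X ^ (2 i - c + 1)`
in the Legendre polynomial of degree `c + 1`. -/
def legendreFunctional : ℕ → (ℤ → ℚ) → ℚ
  | 0, Q => Q 1
  | c + 1, Q => legendreFunctional c (legendreRaise c Q)

theorem legendreFunctional_add (c : ℕ) (Q R : ℤ → ℚ) :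
    legendreFunctional c (fun x => Q x + R x) =
      legendreFunctional c Q + legendreFunctional c R := by
  induction c generalizing Q R with
  | zero => rfl
  | succ c ih =>
    simp only [legendreFunctional]
    rw [← ih]
    congr 1
    funext x
    simp only [legendreRaise]
    ring

theorem legendreFunctional_const_mul (c : ℕ) (a : ℚ) (Q : ℤ → ℚ) :
    legendreFunctional c (fun x => a * Q x) = a * legendreFunctional c Q := by
  induction c generalizing Q with
  | zero => rfl
  | succ c ih =>
    simp only [legendreFunctional]
    rw [← ih]
    congr 1
    funext x
    simp only [legendreRaise]
    ring

theorem legendreFunctional_one (c : ℕ) : legendreFunctional c (fun _ => 1) = 1 := by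
  induction c with
  | zero => rfl
  | succ c ih =>
    refine Eq.trans ?_ ih
    rw [legendreFunctional]
    congr 1
    funext x
    have : (c : ℚ) + 2 ≠ 0 := by positivity
    simp only [legendreRaise]
    field_simp
    ring

/-- The Legendre differential equation, in terms of coefficients. -/
theorem legendreFunctional_ode (c : ℕ) (Q : ℤ → ℚ) :
    legendreFunctional c (fun x => ((x : ℚ) - c) * (x - 1 - c) * Q x +
      (x + 2) * (2 * c + 1 - x) * Q (x + 2)) = 0 := by
  induction c generalizing Q with
  | zero => simp [legendreFunctional]
  | succ c ih =>
    have h := legendreFunctional_const_mul c (1 / (c + 2))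
      (fun x => ((x : ℚ) - c) * (x - 1 - c) * (((x : ℚ) + 2) * Q (x + 2) - (x - 2 - c) * Q x) +
        (x + 2) * (2 * c + 1 - x) *
          ((((x + 2 : ℤ) : ℚ) + 2) * Q (x + 2 + 2) - ((x + 2 : ℤ) - 2 - c) * Q (x + 2)))
    rw [ih (fun x => ((x : ℚ) + 2) * Q (x + 2) - (x - 2 - c) * Q x), mul_zero] at h
    rw [legendreFunctional, ← h]
    congr 1
    funext x
    simp only [legendreRaise]
    push_cast
    ring

/-- The transfer operator of the signed count of symplectic Dellac configurations. -/
def transfer (g : ℕ → ℚ) (c : ℕ) : ℚ :=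
  2 * (c + 1) * (c + 2) * g (c + 1) - c * (c + 1) * g c

theorem legendreFunctional_step (c : ℕ) (Q : ℤ → ℚ) :
    legendreFunctional c (fun x => ((x : ℚ) + 1) * (x + 2) * Q (x + 2) - x * (x + 1) * Q x) =
      transfer (fun d => legendreFunctional d Q) c := by
  have hc : (c : ℚ) + 2 ≠ 0 := by positivity
  have h : (fun x : ℤ => ((x : ℚ) + 1) * (x + 2) * Q (x + 2) - x * (x + 1) * Q x) =
      fun x : ℤ => (2 * ((c : ℚ) + 1) * (c + 2) * legendreRaise c Q x +
        (-(c * (c + 1))) * Q x) + (-1) * (((x : ℚ) - c) * (x - 1 - c) * Q x +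
          (x + 2) * (2 * c + 1 - x) * Q (x + 2)) := by
    funext x
    simp only [legendreRaise]
    field_simp
    ring
  rw [h, legendreFunctional_add, legendreFunctional_add, legendreFunctional_const_mul,
    legendreFunctional_const_mul, legendreFunctional_const_mul, legendreFunctional_ode]
  simp only [transfer, legendreFunctional]
  ring

theorem transfer_iterate_one (m c : ℕ) :
    transfer^[m] (fun _ => 1) c = legendreFunctional c (fun x => (RZ m x : ℚ)) := by
  induction m generalizing c with
  | zero => simp [RZ, legendreFunctional_one]
  | succ m ih =>
    rw [Function.iterate_succ_apply', funext ih, ← legendreFunctional_step]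
    congr 1
    funext x
    simp [RZ]

theorem transfer_iterate_one_zero (m : ℕ) :
    transfer^[m] (fun _ => 1) 0 = (RZ m 1 : ℚ) := by
  rw [transfer_iterate_one, legendreFunctional]

open MvPolynomial in
theorem coeff_add_single_mul_X_pow {k : ℕ} {H : MvPolynomial ℕ ℚ}
    (hH : H ∈ supported ℚ (Set.Iio k)) {e : ℕ →₀ ℕ} (he : e k = 0) (r : ℕ) :
    coeff (e + Finsupp.single k 2) (H * X k ^ r) = if r = 2 then coeff e H else 0 := by
  have hzero : ∀ m : ℕ →₀ ℕ, m k ≠ 0 → coeff m H = 0 := by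
    intro m hm
    by_contra hc
    have hk : k ∈ H.vars :=
      (mem_vars_iff_mem_support k).2 ⟨m, mem_support_iff.2 hc, Finsupp.mem_support_iff.2 hm⟩
    exact lt_irrefl k (mem_supported.1 hH hk)
  rw [X_pow_eq_monomial, coeff_mul_monomial', mul_one]
  split_ifs with h1 h2 h2
  · rw [h2, add_tsub_cancel_right]
  · apply hzero
    have := h1 k
    simp [he] at this ⊢
    omega
  · subst h2
    exact absurd le_add_self h1
  · rfl

/-- The sum of the first `k` variables. -/
noncomputable def prefixSum (k : ℕ) : MvPolynomial ℕ ℚ :=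
  ∑ j ∈ Finset.range k, MvPolynomial.X j

/-- The exponent of the monomial `(X 0 * ⋯ * X (k - 1)) ^ 2`. -/
noncomputable def twos (k : ℕ) : ℕ →₀ ℕ :=
  ∑ j ∈ Finset.range k, Finsupp.single j 2

theorem twos_apply (k j : ℕ) : twos k j = if j < k then 2 else 0 := by
  simp [twos, Finsupp.finsetSum_apply, Finsupp.single_apply]

theorem twos_succ (k : ℕ) : twos (k + 1) = twos k + Finsupp.single k 2 :=
  Finset.sum_range_succ _ _

theorem prefixSum_succ (k : ℕ) : prefixSum (k + 1) = prefixSum k + MvPolynomial.X k :=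
  Finset.sum_range_succ _ _

theorem prefixSum_mem_supported {j k : ℕ} (h : j ≤ k) :
    prefixSum j ∈ MvPolynomial.supported ℚ (Set.Iio k) :=
  Subalgebra.sum_mem _ fun _ hi =>
    MvPolynomial.X_mem_supported.2 ((Finset.mem_range.1 hi).trans_le h)

open MvPolynomial in
theorem coeff_twos_succ {k : ℕ} {G : MvPolynomial ℕ ℚ}
    (hG : G ∈ supported ℚ (Set.Iio k)) (d : ℕ) :
    coeff (twos (k + 1)) (prefixSum (k + 1) ^ d * G) =
      d.choose 2 * coeff (twos k) (prefixSum k ^ (d - 2) * G) := by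
  have hterm : ∀ m, coeff (twos (k + 1))
      (X k ^ m * prefixSum k ^ (d - m) * (d.choose m : MvPolynomial ℕ ℚ) * G) =
        if m = 2 then d.choose 2 * coeff (twos k) (prefixSum k ^ (d - 2) * G) else 0 := by
    intro m
    have hH : prefixSum k ^ (d - m) * G ∈ supported ℚ (Set.Iio k) :=
      Subalgebra.mul_mem _ (Subalgebra.pow_mem _ (prefixSum_mem_supported le_rfl) _) hG
    have hC : (d.choose m : MvPolynomial ℕ ℚ) = C (d.choose m : ℚ) := by simp
    rw [show X k ^ m * prefixSum k ^ (d - m) * (d.choose m : MvPolynomial ℕ ℚ) * G =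
      C (d.choose m : ℚ) * (prefixSum k ^ (d - m) * G * X k ^ m) by rw [hC]; ring,
      coeff_C_mul, twos_succ, coeff_add_single_mul_X_pow hH (by simp [twos_apply])]
    split_ifs with h
    · rw [h]
    · simp
  rw [prefixSum_succ, add_comm (prefixSum k), add_pow, Finset.sum_mul, coeff_sum,
    Finset.sum_congr rfl fun m _ => hterm m, Finset.sum_ite_eq']
  split_ifs with h
  · rfl
  · rw [Nat.choose_eq_zero_of_lt (by simpa using h)]
    simp

/-- The product of the factors `s_{j+1} * (2 u - s_j)` for `j < k`, where `s_j` is the sum of the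
first `j` variables, as a polynomial in `u`. -/
noncomputable def rowProduct (k : ℕ) : Polynomial (MvPolynomial ℕ ℚ) :=
  ∏ j ∈ Finset.range k, Polynomial.C (prefixSum (j + 1)) *
    (Polynomial.C 2 * Polynomial.X - Polynomial.C (prefixSum j))

theorem natDegree_rowProduct_lt (k : ℕ) : (rowProduct k).natDegree < k + 1 := by
  rw [Nat.lt_succ_iff]
  refine (Polynomial.natDegree_prod_le _ _).trans ?_
  refine (Finset.sum_le_card_nsmul _ _ 1 fun j _ => ?_).trans (by simp)
  compute_degree

theorem coeff_zero_rowProduct_succ (k : ℕ) : (rowProduct (k + 1)).coeff 0 =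
    prefixSum (k + 1) * -(prefixSum k * (rowProduct k).coeff 0) := by
  rw [rowProduct, Finset.prod_range_succ, ← rowProduct]
  simp only [Polynomial.mul_coeff_zero, Polynomial.coeff_sub, Polynomial.coeff_C_zero,
    Polynomial.coeff_X_zero]
  ring

theorem coeff_succ_rowProduct_succ (k f : ℕ) : (rowProduct (k + 1)).coeff (f + 1) =
    prefixSum (k + 1) * (2 * (rowProduct k).coeff f -
      prefixSum k * (rowProduct k).coeff (f + 1)) := by
  have h : rowProduct (k + 1) = Polynomial.C (prefixSum (k + 1)) *
      (Polynomial.C 2 * (Polynomial.X * rowProduct k) -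
        Polynomial.C (prefixSum k) * rowProduct k) := by
    rw [rowProduct, Finset.prod_range_succ, ← rowProduct]
    ring
  rw [h, Polynomial.coeff_C_mul, Polynomial.coeff_sub, Polynomial.coeff_C_mul,
    Polynomial.coeff_X_mul, Polynomial.coeff_C_mul]

theorem coeff_rowProduct_mem_supported (k f : ℕ) :
    (rowProduct k).coeff f ∈ MvPolynomial.supported ℚ (Set.Iio k) := by
  induction k generalizing f with
  | zero =>
    simp only [rowProduct, Finset.range_zero, Finset.prod_empty, Polynomial.coeff_one]
    split_ifs
    · exact Subalgebra.one_mem _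
    · exact Subalgebra.zero_mem _
  | succ k ih =>
    have hs := MvPolynomial.supported_mono (R := ℚ) (Set.Iio_subset_Iio k.le_succ)
    have h1 := prefixSum_mem_supported (le_refl (k + 1))
    have h0 := prefixSum_mem_supported k.le_succ
    have h2 : (2 : MvPolynomial ℕ ℚ) ∈ MvPolynomial.supported ℚ (Set.Iio (k + 1)) :=
      ofNat_mem _ 2
    cases f with
    | zero =>
      rw [coeff_zero_rowProduct_succ]
      exact mul_mem h1 (neg_mem (mul_mem h0 (hs (ih 0))))
    | succ f =>
      rw [coeff_succ_rowProduct_succ]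
      exact mul_mem h1 (sub_mem (mul_mem h2 (hs (ih f))) (mul_mem h0 (hs (ih (f + 1)))))

/-- The signed number of ways to fill the first `k` pairs of columns
with `f` rows left unconstrained. -/
noncomputable def freeCount (k f : ℕ) : ℚ :=
  2 ^ k * MvPolynomial.coeff (twos k) (prefixSum k ^ f * (rowProduct k).coeff f)

theorem freeCount_eq_zero (k : ℕ) : freeCount k (k + 1) = 0 := by
  rw [freeCount, Polynomial.coeff_eq_zero_of_natDegree_lt (natDegree_rowProduct_lt k)]
  simp

theorem freeCount_succ_zero (k : ℕ) : freeCount (k + 1) 0 = 0 := by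
  have h := coeff_twos_succ (G := -(prefixSum k * (rowProduct k).coeff 0))
    (neg_mem (mul_mem (prefixSum_mem_supported le_rfl)
      (coeff_rowProduct_mem_supported k 0))) 1
  rw [pow_one] at h
  rw [freeCount, coeff_zero_rowProduct_succ, pow_zero, one_mul, h]
  simp

theorem freeCount_succ_succ (k f : ℕ) : freeCount (k + 1) (f + 1) =
    (f + 1) * (f + 2) * (2 * freeCount k f - freeCount k (f + 1)) := by
  have hmem : 2 * (rowProduct k).coeff f - prefixSum k * (rowProduct k).coeff (f + 1) ∈
      MvPolynomial.supported ℚ (Set.Iio k) :=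
    sub_mem (mul_mem (ofNat_mem _ 2) (coeff_rowProduct_mem_supported k f))
      (mul_mem (prefixSum_mem_supported le_rfl) (coeff_rowProduct_mem_supported k (f + 1)))
  have hsplit : prefixSum k ^ f *
      (2 * (rowProduct k).coeff f - prefixSum k * (rowProduct k).coeff (f + 1)) =
      MvPolynomial.C 2 * (prefixSum k ^ f * (rowProduct k).coeff f) -
        prefixSum k ^ (f + 1) * (rowProduct k).coeff (f + 1) := by
    rw [map_ofNat]
    ring
  rw [freeCount, coeff_succ_rowProduct_succ, ← mul_assoc, ← pow_succ, coeff_twos_succ hmem,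
    show f + 1 + 1 - 2 = f by omega, hsplit, MvPolynomial.coeff_sub, MvPolynomial.coeff_C_mul,
    Nat.cast_choose_two, freeCount, freeCount]
  push_cast
  ring

theorem sum_freeCount_mul (k : ℕ) (g : ℕ → ℚ) :
    ∑ f ∈ Finset.range (k + 1), freeCount k f * g f = transfer^[k] g 0 := by
  induction k generalizing g with
  | zero => simp [freeCount, rowProduct, twos]
  | succ k ih =>
    have hshift : ∑ f ∈ Finset.range (k + 1),
        ((f : ℚ) + 1) * (f + 2) * freeCount k (f + 1) * g (f + 1) =
          ∑ f ∈ Finset.range (k + 1), (f : ℚ) * (f + 1) * freeCount k f * g f := by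
      have h := Finset.sum_range_succ
        (fun f : ℕ => (f : ℚ) * (f + 1) * freeCount k f * g f) (k + 1)
      rw [Finset.sum_range_succ', freeCount_eq_zero] at h
      simp only [Nat.cast_zero, zero_mul, mul_zero, add_zero] at h
      rw [← h]
      refine Finset.sum_congr rfl fun f _ => ?_
      push_cast
      ring
    rw [Function.iterate_succ_apply, ← ih, Finset.sum_range_succ', freeCount_succ_zero, zero_mul,
      add_zero, ← sub_eq_zero, ← Finset.sum_sub_distrib]
    rw [← sub_eq_zero, ← Finset.sum_sub_distrib] at hshift
    rw [← neg_eq_zero, ← Finset.sum_neg_distrib, ← hshift]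
    refine Finset.sum_congr rfl fun f _ => ?_
    rw [freeCount_succ_succ, transfer]
    ring

open MvPolynomial in
theorem two_pow_mul_coeff_twos (n : ℕ) :
    2 ^ n * coeff (twos n) (∏ j ∈ Finset.range n,
      prefixSum (j + 1) * (2 * prefixSum n - prefixSum j)) = (RZ n 1 : ℚ) := by
  have h : ∏ j ∈ Finset.range n, prefixSum (j + 1) * (2 * prefixSum n - prefixSum j) =
      (rowProduct n).eval (prefixSum n) := by
    simp [rowProduct, Polynomial.eval_prod]
  rw [h, Polynomial.eval_eq_sum_range' (natDegree_rowProduct_lt n), coeff_sum, Finset.mul_sum,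
    ← transfer_iterate_one_zero, ← sum_freeCount_mul]
  refine Finset.sum_congr rfl fun f _ => ?_
  rw [freeCount, mul_one, mul_comm (Polynomial.coeff _ _)]

/-- The common index in `[0, n)` of the columns `j` and `2 n - 1 - j`. -/
def pairIndex (n j : ℕ) : ℕ := min j (2 * n - 1 - j)

open MvPolynomial in
theorem sum_X_pairIndex_of_le {n k : ℕ} (h : k ≤ n) :
    ∑ j ∈ Finset.range k, (X (pairIndex n j) : MvPolynomial ℕ ℚ) = prefixSum k := by
  refine Finset.sum_congr rfl fun j hj => ?_
  rw [pairIndex, min_eq_left (by have := Finset.mem_range.1 hj; omega)]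

open MvPolynomial in
theorem sum_X_pairIndex_two_mul_sub {n k : ℕ} (h : k ≤ n) :
    ∑ j ∈ Finset.range (2 * n - k), (X (pairIndex n j) : MvPolynomial ℕ ℚ) =
      2 * prefixSum n - prefixSum k := by
  have hn : prefixSum n = ∑ i ∈ Finset.range (n - k), X (n - 1 - i) + prefixSum k := by
    rw [prefixSum, ← Finset.sum_range_reflect, ← Nat.sub_add_cancel h, Finset.sum_range_add,
      Nat.sub_add_cancel h, prefixSum, ← Finset.sum_range_reflect (X : ℕ → MvPolynomial ℕ ℚ) k]
    congr 1
    refine Finset.sum_congr rfl fun i hi => ?_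
    rw [show n - 1 - (n - k + i) = k - 1 - i by omega]
  have hr : ∑ i ∈ Finset.range (n - k), (X (pairIndex n (n + i)) : MvPolynomial ℕ ℚ) =
      ∑ i ∈ Finset.range (n - k), X (n - 1 - i) := by
    refine Finset.sum_congr rfl fun i _ => ?_
    rw [pairIndex, min_eq_right (by omega), show 2 * n - 1 - (n + i) = n - 1 - i by omega]
  rw [show 2 * n - k = n + (n - k) by omega, Finset.sum_range_add, sum_X_pairIndex_of_le le_rfl,
    hr]
  linear_combination -hn

open MvPolynomial in
theorem prod_sum_X_pairIndex (n : ℕ) :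
    ∏ r : Fin (2 * n), ∑ j ∈ Finset.range (r + 1), (X (pairIndex n j) : MvPolynomial ℕ ℚ) =
      ∏ j ∈ Finset.range n, prefixSum (j + 1) * (2 * prefixSum n - prefixSum j) := by
  rw [Fin.prod_univ_eq_prod_range
    (fun r => ∑ j ∈ Finset.range (r + 1), (X (pairIndex n j) : MvPolynomial ℕ ℚ)) (2 * n),
    two_mul, Finset.prod_range_add, ← Finset.prod_range_reflect
      (fun x => ∑ j ∈ Finset.range (n + x + 1), (X (pairIndex n j) : MvPolynomial ℕ ℚ)) n,
    ← Finset.prod_mul_distrib]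
  refine Finset.prod_congr rfl fun k hk => ?_
  have hk := Finset.mem_range.1 hk
  rw [sum_X_pairIndex_of_le hk, show n + (n - 1 - k) + 1 = 2 * n - k by omega,
    sum_X_pairIndex_two_mul_sub hk.le]

/-- Assignments of a column `f r ≤ r` to each row `r < 2 n` (both numbered from zero) such that
the columns `j` and `2 n - 1 - j` are used twice in total. -/
def halfConfigs (n : ℕ) : Finset (Fin (2 * n) → ℕ) :=
  (Fintype.piFinset fun r : Fin (2 * n) => Finset.range (r + 1)).filter
    fun f => ∀ j < n, (Finset.univ.filter fun r => pairIndex n (f r) = j).card = 2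

theorem mem_halfConfigs {n : ℕ} {f : Fin (2 * n) → ℕ} : f ∈ halfConfigs n ↔
    (∀ r, f r ≤ r) ∧
      ∀ j < n, (Finset.univ.filter fun r => pairIndex n (f r) = j).card = 2 := by
  simp [halfConfigs]

theorem sum_single_pairIndex_eq_twos_iff {n : ℕ} {f : Fin (2 * n) → ℕ} (hf : ∀ r, f r ≤ r) :
    ∑ r, Finsupp.single (pairIndex n (f r)) 1 = twos n ↔
      ∀ j < n, (Finset.univ.filter fun r => pairIndex n (f r) = j).card = 2 := by
  have happly : ∀ j, (∑ r, Finsupp.single (pairIndex n (f r)) 1) j =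
      (Finset.univ.filter fun r => pairIndex n (f r) = j).card := by
    intro j
    simp [Finsupp.finsetSum_apply, Finsupp.single_apply]
  constructor
  · intro h j hj
    rw [← happly, h, twos_apply, if_pos hj]
  · intro h
    ext j
    rw [happly, twos_apply]
    split_ifs with hj
    · exact h j hj
    · rw [Finset.card_eq_zero, Finset.filter_eq_empty_iff]
      intro r _
      have := hf r
      have := r.isLt
      simp only [pairIndex]
      omega

open MvPolynomial in
theorem coeff_twos_eq_card_halfConfigs (n : ℕ) :
    coeff (twos n) (∏ j ∈ Finset.range n,
      prefixSum (j + 1) * (2 * prefixSum n - prefixSum j)) = ((halfConfigs n).card : ℚ) := by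
  rw [← prod_sum_X_pairIndex, Finset.prod_univ_sum, coeff_sum, halfConfigs,
    Finset.card_filter, Nat.cast_sum]
  refine Finset.sum_congr rfl fun f hf => ?_
  have hf' : ∀ r, f r ≤ r := fun r =>
    Nat.lt_succ_iff.1 (Finset.mem_range.1 (Fintype.mem_piFinset.1 hf r))
  have hprod : ∏ r, (X (pairIndex n (f r)) : MvPolynomial ℕ ℚ) =
      monomial (∑ r, Finsupp.single (pairIndex n (f r)) 1) 1 := by
    rw [monomial_sum_one]
    rfl
  rw [hprod, coeff_monomial]
  simp only [sum_single_pairIndex_eq_twos_iff hf', Nat.cast_ite, Nat.cast_one, Nat.cast_zero]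

/-- The centrally symmetric set of dots with lower half given by `f`. -/
def toConfig (n : ℕ) (f : Fin (2 * n) → ℕ) : Finset (ℕ × ℕ) :=
  (Finset.univ.image fun r => (f r + 1, (r : ℕ) + 1)) ∪
    Finset.univ.image fun r => (2 * n - f r, 4 * n - (r : ℕ))

theorem mem_toConfig {n : ℕ} {f : Fin (2 * n) → ℕ} {d : ℕ × ℕ} : d ∈ toConfig n f ↔
    ∃ r : Fin (2 * n), f r + 1 = d.1 ∧ (r : ℕ) + 1 = d.2 ∨
      2 * n - f r = d.1 ∧ 4 * n - (r : ℕ) = d.2 := by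
  simp [toConfig, Prod.ext_iff, exists_or]

theorem card_column_toConfig {n : ℕ} {f : Fin (2 * n) → ℕ} (hf : ∀ r, f r ≤ r) {j : ℕ}
    (h1 : 1 ≤ j) (h2 : j ≤ 2 * n) :
    ((toConfig n f).filter fun d => d.1 = j).card =
      (Finset.univ.filter fun r => pairIndex n (f r) = pairIndex n (j - 1)).card := by
  have himage : ((toConfig n f).filter fun d => d.1 = j) =
      (Finset.univ.filter fun r => pairIndex n (f r) = pairIndex n (j - 1)).image
        fun r => (j, if f r + 1 = j then (r : ℕ) + 1 else 4 * n - r) := by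
    ext ⟨a, b⟩
    simp only [Finset.mem_filter, mem_toConfig, Finset.mem_image, Finset.mem_univ, true_and,
      Prod.mk.injEq]
    simp only [pairIndex]
    constructor
    · rintro ⟨⟨r, h⟩, rfl⟩
      have := hf r
      have := r.isLt
      refine ⟨r, by omega, rfl, ?_⟩
      split_ifs <;> omega
    · rintro ⟨r, h, rfl, hb⟩
      have := hf r
      have := r.isLt
      refine ⟨⟨r, ?_⟩, rfl⟩
      split_ifs at hb <;> omega
  rw [himage, Finset.card_image_of_injective]
  intro r r' h
  have := r.isLt
  have := r'.isLt
  simp only [Prod.mk.injEq, true_and] at h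
  ext
  split_ifs at h <;> omega

theorem card_row_toConfig {n : ℕ} (f : Fin (2 * n) → ℕ) {i : ℕ} (h1 : 1 ≤ i)
    (h2 : i ≤ 4 * n) : ((toConfig n f).filter fun d => d.2 = i).card = 1 := by
  rw [Finset.card_eq_one]
  by_cases hi : i ≤ 2 * n
  · refine ⟨(f ⟨i - 1, by omega⟩ + 1, i), ?_⟩
    ext ⟨a, b⟩
    simp only [Finset.mem_filter, mem_toConfig, Finset.mem_singleton, Prod.mk.injEq]
    constructor
    · rintro ⟨⟨r, h⟩, rfl⟩
      have := r.isLt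
      have hr : r = ⟨b - 1, by omega⟩ := by ext; simp only; omega
      rw [← hr]
      omega
    · rintro ⟨rfl, rfl⟩
      exact ⟨⟨⟨b - 1, by omega⟩, Or.inl ⟨rfl, by simp only; omega⟩⟩, rfl⟩
  · refine ⟨(2 * n - f ⟨4 * n - i, by omega⟩, i), ?_⟩
    ext ⟨a, b⟩
    simp only [Finset.mem_filter, mem_toConfig, Finset.mem_singleton, Prod.mk.injEq]
    constructor
    · rintro ⟨⟨r, h⟩, rfl⟩
      have := r.isLt
      have hr : r = ⟨4 * n - b, by omega⟩ := by ext; simp only; omega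
      rw [← hr]
      omega
    · rintro ⟨rfl, rfl⟩
      exact ⟨⟨⟨4 * n - b, by omega⟩, Or.inr ⟨rfl, by simp only; omega⟩⟩, rfl⟩

theorem isSpDC_toConfig {n : ℕ} {f : Fin (2 * n) → ℕ} (hf : f ∈ halfConfigs n) :
    IsSpDC n (toConfig n f) := by
  obtain ⟨hle, hcol⟩ := mem_halfConfigs.1 hf
  refine ⟨⟨?_, ?_, ?_, ?_⟩, ?_⟩
  · intro d hd
    obtain ⟨r, h⟩ := mem_toConfig.1 hd
    have := hle r
    have := r.isLt
    omega
  · intro i h1 h2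
    exact card_row_toConfig f h1 (by omega)
  · intro j h1 h2
    rw [card_column_toConfig hle h1 h2]
    refine hcol _ ?_
    rw [pairIndex]
    omega
  · intro d hd
    obtain ⟨r, h⟩ := mem_toConfig.1 hd
    have := hle r
    have := r.isLt
    omega
  · intro j i _ _ _ _
    simp only [mem_toConfig]
    refine exists_congr fun r => ?_
    have := hle r
    have := r.isLt
    omega

theorem toConfig_injective (n : ℕ) : Function.Injective (toConfig n) := by
  intro f g h
  funext r
  have hr : (f r + 1, (r : ℕ) + 1) ∈ toConfig n g :=
    h ▸ mem_toConfig.2 ⟨r, Or.inl ⟨rfl, rfl⟩⟩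
  obtain ⟨r', hr'⟩ := mem_toConfig.1 hr
  have := r.isLt
  have := r'.isLt
  obtain rfl : r' = r := by ext; simp only at hr'; omega
  simp only at hr'
  omega

theorem exists_toConfig_eq {n : ℕ} {S : Finset (ℕ × ℕ)} (hS : IsSpDC n S) :
    ∃ f ∈ halfConfigs n, toConfig n f = S := by
  obtain ⟨⟨hbound, hrow, hcol, hdiag⟩, hsymm⟩ := hS
  have hex : ∀ r : Fin (2 * n), ∃ c, (c + 1, (r : ℕ) + 1) ∈ S ∧
      ∀ c', (c', (r : ℕ) + 1) ∈ S → c' = c + 1 := by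
    intro r
    obtain ⟨⟨a, b⟩, hab⟩ := Finset.card_eq_one.1 (hrow (r + 1) (by omega) (by omega))
    have hmem : (a, b) ∈ S.filter fun d => d.2 = (r : ℕ) + 1 := by simp [hab]
    obtain ⟨hS, rfl⟩ := Finset.mem_filter.1 hmem
    obtain ⟨a, rfl⟩ : ∃ a', a = a' + 1 := ⟨a - 1, by have := hbound _ hS; simp only at this; omega⟩
    refine ⟨a, hS, fun c' hc' => ?_⟩
    have : (c', (r : ℕ) + 1) ∈ S.filter fun d => d.2 = (r : ℕ) + 1 := by simp [hc']
    rw [hab] at this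
    simpa using this
  choose f hf hunique using hex
  have hle : ∀ r, f r ≤ r := fun r => by
    have := (hdiag _ (hf r)).1
    simp only at this
    omega
  have heq : toConfig n f = S := by
    ext ⟨a, b⟩
    rw [mem_toConfig]
    constructor
    · rintro ⟨r, ⟨rfl, rfl⟩ | ⟨rfl, rfl⟩⟩
      · exact hf r
      · have h1 := hle r
        have h2 := r.isLt
        have h := (hsymm (f r + 1) (r + 1) (by omega) (by omega) (by omega) (by omega)).1 (hf r)
        rwa [show 2 * n + 1 - (f r + 1) = 2 * n - f r by omega,
          show 4 * n + 1 - ((r : ℕ) + 1) = 4 * n - r by omega] at h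
    · intro hab
      have hb := hbound _ hab
      simp only at hb
      by_cases h : b ≤ 2 * n
      · have hu := hunique ⟨b - 1, by omega⟩ a
        simp only [show b - 1 + 1 = b by omega] at hu
        exact ⟨⟨b - 1, by omega⟩, Or.inl ⟨(hu hab).symm, by simp only; omega⟩⟩
      · have hab' := (hsymm a b (by omega) (by omega) (by omega) (by omega)).1 hab
        have hu := hunique ⟨4 * n - b, by omega⟩ (2 * n + 1 - a)
        simp only [show 4 * n - b + 1 = 4 * n + 1 - b by omega] at hu
        have := hu hab'
        exact ⟨⟨4 * n - b, by omega⟩, Or.inr ⟨by omega, by simp only; omega⟩⟩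
  refine ⟨f, mem_halfConfigs.2 ⟨hle, fun j hj => ?_⟩, heq⟩
  have h := card_column_toConfig hle (show 1 ≤ j + 1 by omega) (show j + 1 ≤ 2 * n by omega)
  rw [heq, hcol _ (by omega) (by omega), Nat.add_sub_cancel,
    show pairIndex n j = j by rw [pairIndex]; omega] at h
  exact h.symm

theorem ncard_SpDC (n : ℕ) : (SpDC n).ncard = (halfConfigs n).card := by
  have h : SpDC n = toConfig n '' (halfConfigs n : Set (Fin (2 * n) → ℕ)) := by
    ext S
    constructor
    · intro hS
      obtain ⟨f, hf, rfl⟩ := exists_toConfig_eq hS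
      exact ⟨f, hf, rfl⟩
    · rintro ⟨f, hf, rfl⟩
      exact isSpDC_toConfig hf
  rw [h, Set.ncard_image_of_injective _ (toConfig_injective n), Set.ncard_coe_finset]

/-- For every `n ≥ 1`, the number of symplectic Dellac configurations of size `2n`
equals `r_n = D_n(1) / 2^n`, i.e. `2^n · #SpDC_{2n} = D_n(1)`. -/
theorem spdc_card_eq_rn (n : ℕ) (hn : 1 ≤ n) :
    (2 : ℤ) ^ n * ((SpDC n).ncard : ℤ) = RZ n 1 := by
  have h := two_pow_mul_coeff_twos n
  rw [coeff_twos_eq_card_halfConfigs, ← ncard_SpDC] at h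
  exact_mod_cast h
end

section
/- For every integer n ≥ 1, there exists a surjective map φ : Tab_n → SP_n such that for every surjective pistol f ∈ SP_n, Σ_{T ∈ φ^{−1}(f)} 2^{fr(T)} = 2^{ndf(f)}. -/
/-- A tableau in `Tab_n`. -/
def IsTab (n : ℕ) (T : Finset (ℕ × ℕ)) : Prop :=
  (∀ d ∈ T, 1 ≤ d.1 ∧ d.1 ≤ n ∧ 1 ≤ d.2 ∧ d.2 ≤ 2 * n) ∧
  (∀ i, 1 ≤ i → i ≤ 2 * n → (T.filter (fun d => d.2 = i)).card = 1) ∧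
  (∀ j, 1 ≤ j → j ≤ n → (T.filter (fun d => d.1 = j)).card = 2) ∧
  (∀ d ∈ T, d.1 ≤ d.2)

/-- The set `Tab_n`. -/
def Tab (n : ℕ) : Set (Finset (ℕ × ℕ)) := {T | IsTab n T}

/-- The number of free dots of `T`, i.e. dots `(j, p)` with `p ≥ 2n + 1 - j`. -/
def fr (n : ℕ) (T : Finset (ℕ × ℕ)) : ℕ :=
  (T.filter (fun d => 2 * n + 1 ≤ d.1 + d.2)).card

/-- A surjective pistol of size `n`: a surjective map `f : [1, 2n] → {2, 4, …, 2n}`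
with `f(j) ≥ j`, encoded as a function `ℕ → ℕ` vanishing outside `[1, 2n]`. -/
def IsSP (n : ℕ) (f : ℕ → ℕ) : Prop :=
  (∀ j, 1 ≤ j → j ≤ 2 * n → Even (f j) ∧ 2 ≤ f j ∧ f j ≤ 2 * n ∧ j ≤ f j) ∧
  (∀ v, Even v → 2 ≤ v → v ≤ 2 * n → ∃ j, 1 ≤ j ∧ j ≤ 2 * n ∧ f j = v) ∧
  (∀ j, j = 0 ∨ 2 * n < j → f j = 0)

/-- The set `SP_n` of surjective pistols of size `n`. -/
def SP (n : ℕ) : Set (ℕ → ℕ) := {f | IsSP n f}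

/-- `j` is a doubled fixed point of `f`. -/
def IsDFP (f : ℕ → ℕ) (j : ℕ) : Prop := f j = j ∧ ∃ j' < j, f j' = j

/-- `ndf(f)`: the number of elements of `{2, 4, …, 2n}` that are not doubled fixed
points of `f`. -/
noncomputable def ndf (n : ℕ) (f : ℕ → ℕ) : ℕ :=
  {i : ℕ | 1 ≤ i ∧ i ≤ n ∧ ¬ (i < n ∧ IsDFP f (2 * i))}.ncard

section GeneratingFunctions

open Polynomial

section Pairing
variable {R : Type*} [CommRing R]

/-- The linear form on `R[X]` sending `X ^ k` to `a k`. -/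
noncomputable def momentForm (a : ℕ → R) : R[X] →ₗ[R] R :=
  Polynomial.lsum fun k => a k • LinearMap.id

theorem momentForm_monomial (a : ℕ → R) (k : ℕ) (c : R) :
    momentForm a (monomial k c) = a k * c := by
  simp [momentForm, Polynomial.sum_monomial_index]

theorem momentForm_C_mul_X_pow (a : ℕ → R) (k : ℕ) (c : R) :
    momentForm a (C c * X ^ k) = a k * c := by
  rw [C_mul_X_pow_eq_monomial, momentForm_monomial]

/-- Transition of the values of the generating function of surjective pistols. -/
def pistolStep (t : R) (g : ℕ → R) (a : ℕ) : R :=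
  (1 + t * a) * (a + 1) * g (a + 1) - a * (1 + t * (a - 1)) * g a

/-- The adjoint of `pistolStep` for `momentForm`. -/
noncomputable def pistolAdj (t : R) (h : R[X]) : R[X] :=
  X * derivative (C t * X * derivative ((X - 1) * h) - C (t - 1) * ((X - 1) * h))

theorem X_mul_derivative_X_pow (k : ℕ) :
    X * derivative (X ^ k : R[X]) = C (k : R) * X ^ k := by
  rcases k with _ | k
  · simp
  · simp; ring

theorem pistolAdj_C_mul_X_pow (t c : R) (k : ℕ) :
    pistolAdj t (C c * X ^ k) = C ((1 + t * k) * (k + 1) * c) * X ^ (k + 1)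
      - C (k * (1 + t * (k - 1)) * c) * X ^ k := by
  have h : (X - 1) * (C c * X ^ k) = C c * X ^ (k + 1) - C c * X ^ k := by ring
  have h1 := X_mul_derivative_X_pow (R := R) k
  have h2 := X_mul_derivative_X_pow (R := R) (k + 1)
  have h3 : C t * X * derivative (C c * X ^ (k + 1) - C c * X ^ k)
      = C (t * c * (k + 1)) * X ^ (k + 1) - C (t * c * k) * X ^ k := by
    simp only [derivative_sub, derivative_C_mul, map_mul, map_add, map_one, map_natCast] at *
    push_cast at h2
    linear_combination C t * C c * h2 - C t * C c * h1
  rw [pistolAdj, h, h3]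
  simp only [map_mul, map_add, map_sub, map_one, map_natCast, mul_sub, derivative_mul,
    derivative_C, derivative_natCast, derivative_one] at *
  push_cast at h2
  linear_combination (C t * C c * (k + 1) - C c * (C t - 1)) * h2
    - (C t * C c * k - C c * (C t - 1)) * h1

theorem momentForm_pistolStep (t : R) (g : ℕ → R) (h : R[X]) :
    momentForm (pistolStep t g) h = momentForm g (pistolAdj t h) := by
  induction h using Polynomial.induction_on' with
  | add p q hp hq =>
    have : pistolAdj t (p + q) = pistolAdj t p + pistolAdj t q := by
      simp only [pistolAdj, mul_add, derivative_add, derivative_sub]; ring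
    rw [this, map_add, map_add, hp, hq]
  | monomial k c =>
    rw [← C_mul_X_pow_eq_monomial, pistolAdj_C_mul_X_pow, map_sub]
    simp only [momentForm_C_mul_X_pow, pistolStep]
    ring

/-- Transition of the moments of the generating function of tableaux. -/
def tabStep (t : R) (a : ℕ → R) (k : ℕ) : R :=
  (k + 2).choose 2 * (a (k + 2) + t * a (k + 1)) + (k + 1) ^ 2 * (a (k + 1) + t * a k)
    + (k + 1).choose 2 * (a k + t * a (k - 1))

end Pairing

/-- The adjoint of `tabStep` for `momentForm`. -/
noncomputable def tabAdj (t : ℚ[X]) (h : ℚ[X][X]) : ℚ[X][X] :=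
  (X + C t) * (X + 1) *
    ((X + 1) * (C (C (1 / 2)) * derivative (derivative (X * h))) + derivative (X * h))

theorem two_mul_C_C_half : (2 : ℚ[X][X]) * C (C (1 / 2)) = 1 := by
  rw [← map_ofNat (C : ℚ[X] →+* ℚ[X][X]) 2, ← map_ofNat (C : ℚ →+* ℚ[X]) 2, ← C_mul, ← C_mul]
  norm_num

theorem momentForm_tabStep (t : ℚ[X]) (a : ℕ → ℚ[X]) (h : ℚ[X][X]) :
    momentForm (tabStep t a) h = momentForm a (tabAdj t h) := by
  induction h using Polynomial.induction_on' with
  | add p q hp hq =>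
    have : tabAdj t (p + q) = tabAdj t p + tabAdj t q := by
      simp only [tabAdj, mul_add, derivative_add]; ring
    rw [this, map_add, map_add, hp, hq]
  | monomial k c =>
    have hh := two_mul_C_C_half
    rw [tabAdj]
    generalize (C (C (1 / 2)) : ℚ[X][X]) = d at hh
    have hc (n : ℕ) : (((n + 1).choose 2 : ℕ) : ℚ[X][X]) = d * (((n : ℚ[X][X]) + 1) * n) := by
      have h2 : ((n + 1).choose 2) * 2 = (n + 1) * n := by
        rw [Nat.choose_two_right]
        exact Nat.div_mul_cancel (by simpa [mul_comm] using (Nat.even_mul_succ_self n).two_dvd)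
      have h3 := congrArg (Nat.cast : ℕ → ℚ[X][X]) h2
      push_cast at h3
      linear_combination d * h3 - ((n + 1).choose 2 : ℚ[X][X]) * hh
    have key : (X + C t) * (X + 1) * ((X + 1) * (d * derivative (derivative (X * monomial k c)))
          + derivative (X * monomial k c)) =
        C ((k + 2).choose 2 * c) * X ^ (k + 2) +
        C (((k + 2).choose 2 * t + (k + 1) ^ 2) * c) * X ^ (k + 1) +
        C (((k + 1) ^ 2 * t + (k + 1).choose 2) * c) * X ^ k +
        C ((k + 1).choose 2 * t * c) * X ^ (k - 1) := by
      rw [← C_mul_X_pow_eq_monomial]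
      simp only [map_mul, map_add, map_natCast, hc k, hc (k + 1), map_pow, map_one]
      rcases k with _ | k
      · simp
        linear_combination (-X * C c * (X + C t)) * hh
      · have hX : X * (C c * X ^ (k + 1)) = C c * X ^ (k + 1 + 1) := by ring
        simp only [hX, derivative_X_pow_succ, map_add, map_one, map_natCast, derivative_mul,
          derivative_C, derivative_zero, derivative_one, derivative_natCast, Nat.add_sub_cancel]
        push_cast
        linear_combination ((X + C t) * C c * (k + 2) * ((k + 1) * X ^ (k + 1) - X ^ (k + 2))) * hh
    rw [key]
    simp only [map_add, momentForm_C_mul_X_pow, tabStep, momentForm_monomial]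
    ring

/-- The subsemiring of polynomials with all coefficients in a given subsemiring. -/
def coeffSubsemiring {A : Type*} [CommSemiring A] (S : Subsemiring A) : Subsemiring A[X] where
  carrier := {p | ∀ k, p.coeff k ∈ S}
  mul_mem' {p q} hp hq k := by
    rw [coeff_mul]
    exact sum_mem fun x _ => mul_mem (hp _) (hq _)
  one_mem' k := by
    rw [coeff_one]
    split_ifs
    exacts [one_mem S, zero_mem S]
  add_mem' {p q} hp hq k := by
    rw [coeff_add]
    exact add_mem (hp k) (hq k)
  zero_mem' k := by simp

section
variable {A : Type*} [CommSemiring A] {S : Subsemiring A} {p q : A[X]} {c : A}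

theorem C_mem_coeffSubsemiring (hc : c ∈ S) : C c ∈ coeffSubsemiring S := by
  intro k
  rw [coeff_C]
  split_ifs
  exacts [hc, zero_mem S]

theorem X_mem_coeffSubsemiring : (X : A[X]) ∈ coeffSubsemiring S := by
  intro k
  rw [coeff_X]
  split_ifs
  exacts [one_mem S, zero_mem S]

theorem derivative_mem_coeffSubsemiring (hp : p ∈ coeffSubsemiring S) :
    derivative p ∈ coeffSubsemiring S := by
  intro k
  rw [coeff_derivative]
  exact mul_mem (hp _) (add_mem (natCast_mem S k) (one_mem S))

theorem comp_mem_coeffSubsemiring (hp : p ∈ coeffSubsemiring S) (hq : q ∈ coeffSubsemiring S) :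
    p.comp q ∈ coeffSubsemiring S := by
  rw [comp_eq_sum_left]
  exact sum_mem fun k _ => mul_mem (C_mem_coeffSubsemiring (hp k)) (pow_mem hq k)

theorem eval_zero_mem_of_mem_coeffSubsemiring (hp : p ∈ coeffSubsemiring S) : p.eval 0 ∈ S := by
  rw [← coeff_zero_eq_eval_zero]
  exact hp 0

end

/-- `pistolAdj` in the variable `X - 1`. -/
noncomputable def pistolShift (t : ℚ[X]) (h : ℚ[X][X]) : ℚ[X][X] :=
  (1 + X) * (C t * (1 + X) * derivative (derivative (X * h)) + derivative (X * h))

/-- The conjugate of `tabAdj` by the multiplication by `X + 1`. -/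
noncomputable def tabConj (t : ℚ[X]) (h : ℚ[X][X]) : ℚ[X][X] :=
  (X + C t) * (X + 1) ^ 2 * C (C (1 / 2)) * derivative (derivative (X * h))

theorem pistolAdj_comp (t : ℚ[X]) (h : ℚ[X][X]) :
    pistolAdj t (h.comp (X - 1)) = (pistolShift t h).comp (X - 1) := by
  simp only [pistolAdj, pistolShift, derivative_mul, derivative_X, derivative_one, derivative_zero,
    zero_comp, derivative_comp, mul_comp, add_comp, X_comp, C_comp, one_comp, derivative_C,
    derivative_add, map_sub, map_one]
  ring

theorem tabConj_X_add_one_mul (t : ℚ[X]) (h : ℚ[X][X]) :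
    tabConj t ((X + 1) * h) = (X + 1) * tabAdj t h := by
  simp only [tabConj, tabAdj, derivative_mul, derivative_X, derivative_one, derivative_add,
    derivative_zero]
  linear_combination (X + C t) * (X + 1) ^ 2 * (X * derivative h + h) * two_mul_C_C_half

/-- The intertwining map between `pistolShift` and `tabConj`, up to multiples of `t - 2`. -/
noncomputable def intertwiner (t : ℚ[X]) (h : ℚ[X][X]) : ℚ[X][X] :=
  (X + C t) * h.comp (X * (X + 2))

theorem intertwiner_pistolShift (t : ℚ[X]) (h : ℚ[X][X]) :
    intertwiner t (pistolShift t h) = tabConj t (intertwiner t h) +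
      C (t - 2) * ((X + C t) * (X + 1) ^ 2 * X *
        (X * (X + 1) ^ 2 * (derivative (derivative h)).comp (X * (X + 2)) +
          (2 * X + 1) * (derivative h).comp (X * (X + 2)))) := by
  have hh := two_mul_C_C_half
  rw [tabConj]
  generalize (C (C (1 / 2)) : ℚ[X][X]) = d at hh
  have h2 : (C 2 : ℚ[X][X]) = 2 := rfl
  simp only [intertwiner, pistolShift, derivative_mul, derivative_X, derivative_one,
    derivative_add, derivative_comp, mul_comp, add_comp, X_comp, C_comp, one_comp, derivative_C,
    derivative_zero, derivative_ofNat, zero_comp, map_sub, h2]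
  linear_combination (-(X + C t) * (X + 1) ^ 2 *
    (h.comp (X * (X + 2)) + (derivative h).comp (X * (X + 2)) *
      (5 * X ^ 2 + (4 + 3 * C t) * X + 2 * C t) +
      2 * (X + 1) ^ 2 * X * (X + C t) * (derivative (derivative h)).comp (X * (X + 2)))) * hh

/-- Polynomials with nonnegative coefficients. -/
abbrev nonnegCoeffs : Subsemiring ℚ[X] := coeffSubsemiring (Subsemiring.nonneg ℚ)

theorem pistolShift_mem {t : ℚ[X]} (ht : t ∈ nonnegCoeffs) {h : ℚ[X][X]}
    (hh : h ∈ coeffSubsemiring nonnegCoeffs) :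
    pistolShift t h ∈ coeffSubsemiring nonnegCoeffs := by
  have hX : (X : ℚ[X][X]) ∈ coeffSubsemiring nonnegCoeffs := X_mem_coeffSubsemiring
  have h1 := add_mem (one_mem _) hX
  have hd := derivative_mem_coeffSubsemiring (mul_mem hX hh)
  exact mul_mem h1 (add_mem (mul_mem (mul_mem (C_mem_coeffSubsemiring ht) h1)
    (derivative_mem_coeffSubsemiring hd)) hd)

theorem tabConj_mem {t : ℚ[X]} (ht : t ∈ nonnegCoeffs) {h : ℚ[X][X]}
    (hh : h ∈ coeffSubsemiring nonnegCoeffs) :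
    tabConj t h ∈ coeffSubsemiring nonnegCoeffs := by
  have hX : (X : ℚ[X][X]) ∈ coeffSubsemiring nonnegCoeffs := X_mem_coeffSubsemiring
  have hhalf : (1 / 2 : ℚ) ∈ Subsemiring.nonneg ℚ := by
    rw [Subsemiring.mem_nonneg]; norm_num
  exact mul_mem (mul_mem (mul_mem (add_mem hX (C_mem_coeffSubsemiring ht))
    (pow_mem (add_mem hX (one_mem _)) 2)) (C_mem_coeffSubsemiring (C_mem_coeffSubsemiring hhalf)))
    (derivative_mem_coeffSubsemiring (derivative_mem_coeffSubsemiring (mul_mem hX hh)))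

theorem exists_intertwiner_iterate {t : ℚ[X]} (ht : t ∈ nonnegCoeffs) (n : ℕ) :
    (pistolShift t)^[n] 1 ∈ coeffSubsemiring nonnegCoeffs ∧
    ∃ Y ∈ coeffSubsemiring nonnegCoeffs, intertwiner t ((pistolShift t)^[n] 1) =
      (tabConj t)^[n] (X + C t) + C (t - 2) * Y := by
  induction n with
  | zero => exact ⟨one_mem _, 0, zero_mem _, by simp [intertwiner]⟩
  | succ n ih =>
    obtain ⟨hK, Y, hY, h⟩ := ih
    have hX : (X : ℚ[X][X]) ∈ coeffSubsemiring nonnegCoeffs := X_mem_coeffSubsemiring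
    have h1 := add_mem hX (one_mem _)
    have h2 : (2 : ℚ[X][X]) ∈ coeffSubsemiring nonnegCoeffs := ofNat_mem _ 2
    have hs := mul_mem hX (add_mem hX h2)
    have hd := derivative_mem_coeffSubsemiring hK
    simp only [Function.iterate_succ_apply']
    refine ⟨pistolShift_mem ht hK, _, add_mem (tabConj_mem ht hY)
      (mul_mem (mul_mem (mul_mem (add_mem hX (C_mem_coeffSubsemiring ht)) (pow_mem h1 2)) hX)
        (add_mem (mul_mem (mul_mem hX (pow_mem h1 2))
          (comp_mem_coeffSubsemiring (derivative_mem_coeffSubsemiring hd) hs))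
          (mul_mem (add_mem (mul_mem h2 hX) (one_mem _)) (comp_mem_coeffSubsemiring hd hs)))), ?_⟩
    rw [intertwiner_pistolShift, h]
    simp only [tabConj, mul_add, derivative_add, derivative_mul, derivative_C, derivative_X,
      derivative_one, derivative_zero]
    ring

theorem eval_zero_tabConj_iterate (t : ℚ[X]) (n : ℕ) (hn : 1 ≤ n) :
    ((tabConj t)^[n] (X + C t)).eval 0 = ((tabAdj t)^[n] 1).eval 0 := by
  have h (n : ℕ) : (tabConj t)^[n] (X + 1) = (X + 1) * (tabAdj t)^[n] 1 := by
    induction n with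
    | zero => simp
    | succ n ih => simp only [Function.iterate_succ_apply', ih, tabConj_X_add_one_mul]
  obtain ⟨n, rfl⟩ := Nat.exists_eq_add_of_le' hn
  have h1 : tabConj t (X + C t) = tabConj t (X + 1) := by
    simp [tabConj, mul_add]
  rw [Function.iterate_succ_apply, h1, ← Function.iterate_succ_apply, h]
  simp

/-- Up to a factor `X`, iterates of `pistolStep` and `tabStep` differ by `X - 2` times a polynomial
with nonnegative coefficients. -/
theorem exists_pistolStep_iterate_eq (n : ℕ) (hn : 1 ≤ n) :
    ∃ Y ∈ nonnegCoeffs, X * (pistolStep (X : ℚ[X]))^[n] (fun _ => 1) 0 =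
      (tabStep (X : ℚ[X]))^[n] (fun k => if k = 0 then 1 else 0) 0 + (X - 2) * Y := by
  obtain ⟨-, Y, hY, h⟩ := exists_intertwiner_iterate (t := X) X_mem_coeffSubsemiring n
  have hg (n : ℕ) : ∀ g h, momentForm ((pistolStep (X : ℚ[X]))^[n] g) h
      = momentForm g ((pistolAdj X)^[n] h) := by
    induction n with
    | zero => simp
    | succ n ih =>
      intro g h
      rw [Function.iterate_succ_apply, Function.iterate_succ_apply', ih, momentForm_pistolStep]
  have ha (n : ℕ) : ∀ a h, momentForm ((tabStep (X : ℚ[X]))^[n] a) h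
      = momentForm a ((tabAdj X)^[n] h) := by
    induction n with
    | zero => simp
    | succ n ih =>
      intro g h
      rw [Function.iterate_succ_apply, Function.iterate_succ_apply', ih, momentForm_tabStep]
  have hone (a : ℕ → ℚ[X]) : momentForm a 1 = a 0 := by
    simpa using momentForm_monomial a 0 1
  have heval (p : ℚ[X][X]) : momentForm (fun _ => 1) p = p.eval 1 := by
    induction p using Polynomial.induction_on' with
    | add p q hp hq => simp [hp, hq]
    | monomial k c => simp [momentForm_monomial]
  have heval' (p : ℚ[X][X]) : momentForm (fun k => if k = 0 then 1 else 0) p = p.eval 0 := by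
    induction p using Polynomial.induction_on' with
    | add p q hp hq => simp [hp, hq]
    | monomial k c => rcases k with _ | k <;> simp [momentForm_monomial, -monomial_zero_left]
  have hcomp : (pistolAdj (X : ℚ[X]))^[n] 1 = ((pistolShift X)^[n] 1).comp (X - 1) := by
    clear h hn
    induction n with
    | zero => simp
    | succ n ih => simp only [Function.iterate_succ_apply', ih, pistolAdj_comp]
  refine ⟨Y.eval 0, eval_zero_mem_of_mem_coeffSubsemiring hY, ?_⟩
  rw [← hone (_^[n] _), ← hone (_^[n] _), hg, ha, heval, heval', hcomp,
    ← eval_zero_tabConj_iterate _ _ hn]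
  have := congrArg (Polynomial.eval 0) h
  simpa [intertwiner, eval_comp] using this

/-- Powers of two fit into boxes whose sizes are powers of two as soon as, for every `k`, the
powers with exponent at least `k` have total size at most that of the boxes with exponent at
least `k`. -/
theorem exists_packing {α β : Type*} [DecidableEq α] [DecidableEq β] [Nonempty β]
    (A : Finset α) (B : Finset β) (a : α → ℕ) (b : β → ℕ)
    (h : ∀ k, ∑ x ∈ A with k ≤ a x, 2 ^ a x ≤ ∑ y ∈ B with k ≤ b y, 2 ^ b y) :
    ∃ φ : α → β, (∀ x ∈ A, φ x ∈ B) ∧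
      ∀ y ∈ B, ∑ x ∈ A with φ x = y, 2 ^ a x ≤ 2 ^ b y := by
  induction A using Finset.induction_on_min_value a with
  | empty => exact ⟨fun _ => Classical.arbitrary β, by simp, by simp⟩
  | insert x s hx hmin ih =>
    obtain ⟨φ, hφ, hle⟩ := ih fun k => (Finset.sum_le_sum_of_subset
      (Finset.filter_subset_filter _ (Finset.subset_insert x s))).trans (h k)
    obtain ⟨y, hy, hky, hlt⟩ : ∃ y ∈ B, a x ≤ b y ∧
        ∑ z ∈ s with φ z = y, 2 ^ a z < 2 ^ b y := by
      by_contra! hfull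
      have h1 := h (a x)
      rw [Finset.filter_true_of_mem (by simpa using hmin), Finset.sum_insert hx] at h1
      have h2 : ∑ y ∈ B with a x ≤ b y, 2 ^ b y ≤
          ∑ y ∈ B with a x ≤ b y, ∑ z ∈ s with φ z = y, 2 ^ a z :=
        Finset.sum_le_sum fun y hy => hfull y (Finset.mem_filter.1 hy).1 (Finset.mem_filter.1 hy).2
      have h3 : ∑ y ∈ B with a x ≤ b y, ∑ z ∈ s with φ z = y, 2 ^ a z ≤ ∑ z ∈ s, 2 ^ a z :=
        (Finset.sum_le_sum_of_subset (Finset.filter_subset _ _)).trans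
          (Finset.sum_fiberwise_of_maps_to hφ _).le
      have := Nat.two_pow_pos (a x)
      omega
    have hroom : ∑ z ∈ s with φ z = y, 2 ^ a z + 2 ^ a x ≤ 2 ^ b y := by
      obtain ⟨c, hc⟩ : 2 ^ a x ∣ ∑ z ∈ s with φ z = y, 2 ^ a z :=
        Finset.dvd_sum fun z hz => pow_dvd_pow 2 (hmin z (Finset.mem_filter.1 hz).1)
      obtain ⟨d, hd⟩ : 2 ^ a x ∣ 2 ^ b y := pow_dvd_pow 2 hky
      rw [hc, hd] at hlt ⊢
      have := Nat.lt_of_mul_lt_mul_left hlt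
      calc 2 ^ a x * c + 2 ^ a x = 2 ^ a x * (c + 1) := by ring
        _ ≤ 2 ^ a x * d := Nat.mul_le_mul_left _ this
    have hne : ∀ z ∈ s, Function.update φ x y z = φ z := fun z hz =>
      Function.update_of_ne (ne_of_mem_of_not_mem hz hx) _ _
    have hfib (y' : β) : s.filter (fun z => Function.update φ x y z = y') =
        s.filter (fun z => φ z = y') := Finset.filter_congr fun z hz => by rw [hne z hz]
    refine ⟨Function.update φ x y, fun z hz => ?_, fun y' hy' => ?_⟩
    · rcases Finset.mem_insert.1 hz with rfl | hz
      · simpa using hy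
      · simpa [hne z hz] using hφ z hz
    · rw [Finset.filter_insert, hfib, Function.update_self]
      split_ifs with hyy
      · subst hyy
        rw [Finset.sum_insert (by simp [hx]), add_comm]
        exact hroom
      · exact hle y' hy'

/-- If the generating polynomials differ by `X - 2` times a nonnegative polynomial, then the
powers of two indexed by `A` can be grouped into those indexed by `B`. -/
theorem exists_grouping {α β : Type*} [DecidableEq α] [DecidableEq β] [Nonempty β]
    (A : Finset α) (B : Finset β) (a : α → ℕ) (b : β → ℕ) {Y : ℚ[X]} (hY : Y ∈ nonnegCoeffs)
    (h : ∑ y ∈ B, (X : ℚ[X]) ^ b y = ∑ x ∈ A, X ^ a x + (X - 2) * Y) :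
    ∃ φ : α → β, (∀ x ∈ A, φ x ∈ B) ∧
      ∀ y ∈ B, ∑ x ∈ A with φ x = y, 2 ^ a x = 2 ^ b y := by
  have hpow (c : ℕ → ℚ) (k : ℕ) : momentForm c (X ^ k) = c k := by
    rw [X_pow_eq_monomial, momentForm_monomial, mul_one]
  have hdom (k : ℕ) : ∑ x ∈ A with k ≤ a x, 2 ^ a x ≤ ∑ y ∈ B with k ≤ b y, 2 ^ b y := by
    have h1 := congrArg (momentForm fun j => if k ≤ j then (2 : ℚ) ^ j else 0) h
    have h2 : 0 ≤ momentForm (fun j => if k ≤ j then (2 : ℚ) ^ j else 0) ((X - 2) * Y) := by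
      rw [Y.as_sum_support_C_mul_X_pow, Finset.mul_sum, map_sum]
      refine Finset.sum_nonneg fun j _ => ?_
      have h3 : (X - 2) * (C (Y.coeff j) * X ^ j)
          = C (Y.coeff j) * X ^ (j + 1) - C (2 * Y.coeff j) * X ^ j := by
        rw [C_mul, show (C 2 : ℚ[X]) = 2 from rfl]
        ring
      have h4 : 0 ≤ Y.coeff j := hY j
      rw [h3, map_sub, momentForm_C_mul_X_pow, momentForm_C_mul_X_pow]
      split_ifs
      · rw [pow_succ]; nlinarith
      · have : 0 ≤ (2 : ℚ) ^ (j + 1) * Y.coeff j := by positivity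
        linarith
      · omega
      · simp
    simp only [map_add, map_sum, hpow] at h1
    rw [← Finset.sum_filter, ← Finset.sum_filter] at h1
    have h5 : (∑ x ∈ A with k ≤ a x, (2 : ℚ) ^ a x) ≤ ∑ y ∈ B with k ≤ b y, (2 : ℚ) ^ b y := by
      linarith
    exact_mod_cast h5
  obtain ⟨φ, hφ, hle⟩ := exists_packing A B a b hdom
  refine ⟨φ, hφ, (Finset.sum_eq_sum_iff_of_le hle).1 ?_⟩
  rw [Finset.sum_fiberwise_of_maps_to hφ]
  have h1 := congrArg (Polynomial.eval 2) h
  simp only [eval_finsetSum, eval_pow, eval_X, eval_add, eval_mul, eval_sub, eval_ofNat, sub_self,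
    zero_mul, add_zero] at h1
  exact_mod_cast h1.symm

/-- Product of the linear forms of the rows of a tableau, where `w` is an extra variable of weight
`t` available to the rows that may contain a free dot. -/
noncomputable def tabProd {R : Type} [CommRing R] (t w : R) (m : ℕ) : MvPolynomial (Fin m) R :=
  (∏ i : Fin m, ∑ j : Fin m, if i ≤ j then MvPolynomial.X j else 0) *
    ∏ i : Fin m, (MvPolynomial.C (t * w) +
      ∑ j : Fin m, if j ≤ i then MvPolynomial.C t * MvPolynomial.X j else MvPolynomial.X j)

/-- View the first variable as a polynomial variable of the coefficient ring. -/
noncomputable def firstVarHom (R : Type) [CommRing R] (m : ℕ) :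
    MvPolynomial (Fin (m + 1)) R →+* MvPolynomial (Fin m) R[X] :=
  MvPolynomial.eval₂Hom (MvPolynomial.C.comp C)
    (Fin.cons (MvPolynomial.C X) MvPolynomial.X)

theorem firstVarHom_coeff {R : Type} [CommRing R] {m : ℕ} (f : MvPolynomial (Fin (m + 1)) R)
    (i : ℕ) (s : Fin m →₀ ℕ) :
    ((firstVarHom R m f).coeff s).coeff i = f.coeff (Finsupp.cons i s) := by
  induction f using MvPolynomial.induction_on' with
  | add p q hp hq => simp [hp, hq]
  | monomial d c =>
    have h : firstVarHom R m (MvPolynomial.monomial d c) =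
        MvPolynomial.monomial d.tail (monomial (d 0) c) := by
      rw [firstVarHom, MvPolynomial.coe_eval₂Hom, MvPolynomial.eval₂_monomial,
        Finsupp.prod_fintype _ _ (by simp), Fin.prod_univ_succ,
        MvPolynomial.monomial_eq, Finsupp.prod_fintype _ _ (by simp), ← C_mul_X_pow_eq_monomial]
      simp [mul_assoc, Finsupp.tail_apply]
    rw [h, MvPolynomial.coeff_monomial, MvPolynomial.coeff_monomial]
    have hd : d = Finsupp.cons i s ↔ d 0 = i ∧ d.tail = s := by
      constructor
      · rintro rfl
        simp
      · rintro ⟨rfl, rfl⟩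
        simp
    by_cases h1 : d.tail = s <;> by_cases h2 : d 0 = i <;> simp [hd, h1, h2, coeff_monomial]

theorem firstVarHom_tabProd {R : Type} [CommRing R] (t w : R) (m : ℕ) :
    firstVarHom R m (tabProd t w (m + 1)) =
      (MvPolynomial.C X + ∑ j, MvPolynomial.X j) *
      (MvPolynomial.C (C t * (C w + X)) + ∑ j, MvPolynomial.X j) *
      tabProd (C t) (C w + X) m := by
  simp only [tabProd, Fin.prod_univ_succ, Fin.sum_univ_succ, map_mul, map_add, map_prod, map_sum]
  simp [firstVarHom, apply_ite, Fin.succ_ne_zero]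
  simp only [mul_add, add_assoc]
  ring

theorem map_tabStep {R S : Type*} [CommRing R] [CommRing S] (φ : R →+* S) (t : R) (a : ℕ → R)
    (k : ℕ) : φ (tabStep t a k) = tabStep (φ t) (fun j => φ (a j)) k := by
  simp [tabStep]

theorem map_tabStep_iterate {R S : Type*} [CommRing R] [CommRing S] (φ : R →+* S) (t : R)
    (m : ℕ) : ∀ k, φ ((tabStep t)^[m] (fun k => if k = 0 then 1 else 0) k) =
      (tabStep (φ t))^[m] (fun k => if k = 0 then 1 else 0) k := by
  induction m with
  | zero => simp [apply_ite φ]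
  | succ m ih =>
    intro k
    simp only [Function.iterate_succ_apply', map_tabStep, ih]

/-- Extraction of the coefficient of `X ^ 2` in the recursion for `tabProd`. -/
theorem coeff_two_sum_eq_tabStep {R : Type*} [CommRing R] (t w : R) (a : ℕ → R) (k : ℕ) :
    (∑ j ∈ Finset.range (k + 2), ((k + 1).choose j : R[X]) * X ^ j *
      ((C w + X) ^ (k + 2 - j) * C (a (k + 2 - j)) +
        C t * (C w + X) * ((C w + X) ^ (k + 1 - j) * C (a (k + 1 - j)))) : R[X]).coeff 2 =
      w ^ k * tabStep t a k := by
  have h (j : ℕ) (hj : j < k + 2) : (((k + 1).choose j : R[X]) * X ^ j *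
      ((C w + X) ^ (k + 2 - j) * C (a (k + 2 - j)) +
        C t * (C w + X) * ((C w + X) ^ (k + 1 - j) * C (a (k + 1 - j))))).coeff 2 =
      if j ≤ 2 then (k + 1).choose j * (w ^ k * (k + 2 - j).choose (2 - j) *
        (a (k + 2 - j) + t * a (k + 1 - j))) else 0 := by
    have e : ((k + 1).choose j : R[X]) * X ^ j *
      ((C w + X) ^ (k + 2 - j) * C (a (k + 2 - j)) +
        C t * (C w + X) * ((C w + X) ^ (k + 1 - j) * C (a (k + 1 - j)))) =
        C ((k + 1).choose j * (a (k + 2 - j) + t * a (k + 1 - j))) *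
          ((X + C w) ^ (k + 2 - j) * X ^ j) := by
      rw [show k + 2 - j = (k + 1 - j) + 1 by omega]
      simp only [map_mul, map_add, map_natCast]
      ring
    rw [e, coeff_C_mul, coeff_mul_X_pow']
    split_ifs with h2
    · rw [coeff_X_add_C_pow, show k + 2 - j - (2 - j) = k by omega]
      ring
    · simp
  rw [finsetSum_coeff, Finset.sum_congr rfl fun j hj => h j (Finset.mem_range.1 hj)]
  rcases k with _ | k
  · simp [Finset.sum_range_succ, tabStep]
  · rw [Finset.sum_range_succ', Finset.sum_range_succ', Finset.sum_range_succ',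
      Finset.sum_eq_zero (fun j _ => if_neg (by omega))]
    simp [tabStep]
    ring

theorem coeff_tabProd (m : ℕ) : ∀ {R : Type} [CommRing R] (t w : R) (k : ℕ),
    (tabProd t w m * (∑ j, MvPolynomial.X j) ^ k).coeff (Finsupp.equivFunOnFinite.symm fun _ => 2) =
      w ^ k * (tabStep t)^[m] (fun k => if k = 0 then 1 else 0) k := by
  induction m with
  | zero =>
    intro R _ t w k
    rcases k with _ | k
    · simp [tabProd, MvPolynomial.coeff_one]
      exact fun h => absurd (Subsingleton.elim _ _) h
    · simp
  | succ m ih =>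
    intro R _ t w k
    have hs : (Finsupp.equivFunOnFinite.symm fun _ => 2 : Fin (m + 1) →₀ ℕ) =
        Finsupp.cons 2 (Finsupp.equivFunOnFinite.symm fun _ => 2) := by
      ext i
      refine Fin.cases ?_ (fun i => ?_) i <;> simp
    have hY : firstVarHom R m (∑ j, MvPolynomial.X j) =
        MvPolynomial.C X + ∑ j, MvPolynomial.X j := by
      simp [firstVarHom, Fin.sum_univ_succ]
    have key : firstVarHom R m (tabProd t w (m + 1) * (∑ j, MvPolynomial.X j) ^ k) =
        ∑ j ∈ Finset.range (k + 2), MvPolynomial.C ((k + 1).choose j * X ^ j) *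
          (tabProd (C t) (C w + X) m * (∑ j, MvPolynomial.X j) ^ (k + 2 - j) +
          MvPolynomial.C (C t * (C w + X)) *
            (tabProd (C t) (C w + X) m * (∑ j, MvPolynomial.X j) ^ (k + 1 - j))) := by
      rw [map_mul, firstVarHom_tabProd, map_pow, hY]
      generalize (∑ j, MvPolynomial.X j : MvPolynomial (Fin m) R[X]) = Y
      generalize tabProd (C t) (C w + X) m = Φ
      calc _ = (MvPolynomial.C X + Y) ^ (k + 1) * (MvPolynomial.C (C t * (C w + X)) + Y) * Φ := by
            ring
        _ = _ := by
            rw [add_pow, Finset.sum_mul, Finset.sum_mul]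
            refine Finset.sum_congr rfl fun j hj => ?_
            rw [show k + 2 - j = (k + 1 - j) + 1 by have := Finset.mem_range.1 hj; omega]
            simp only [map_mul, map_pow, map_natCast]
            ring
    rw [hs, ← firstVarHom_coeff, key, MvPolynomial.coeff_sum]
    simp only [MvPolynomial.coeff_C_mul, MvPolynomial.coeff_add, ih]
    simp only [← map_tabStep_iterate (C : R →+* R[X])]
    rw [coeff_two_sum_eq_tabStep, Function.iterate_succ_apply']

/-- Iteration of `pistolStep` as a sum over subsets of `Fin m`. -/
theorem sum_bool_eq_pistolStep_iterate {R : Type*} [CommRing R] (t : R) (m : ℕ) : ∀ h : ℕ → R,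
    ∑ y : Fin m → Bool, h (∑ v, if y v then 1 else 0) *
      ∏ i, ((∑ v, if i ≤ v ∧ y v then (1 : R) else 0) *
        (if y i then 1 + t * ∑ v, (if i < v ∧ y v then (1 : R) else 0)
          else t - 1 - t * ∑ v, (if i < v ∧ y v then (1 : R) else 0))) =
      (pistolStep t)^[m] h 0 := by
  induction m with
  | zero => simp
  | succ m ih =>
    intro h
    rw [Function.iterate_succ_apply, ← ih, ← (Fin.consEquiv fun _ => Bool).sum_comp,
      Fintype.sum_prod_type, Fintype.sum_bool, ← Finset.sum_add_distrib]
    refine Finset.sum_congr rfl fun y _ => ?_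
    simp only [Fin.prod_univ_succ, Fin.sum_univ_succ, Fin.consEquiv_apply, Fin.cons_zero,
      Fin.cons_succ, Fin.succ_le_succ_iff, Fin.succ_lt_succ_iff, pistolStep]
    simp
    ring_nf

/-- The weight of the set of doubled fixed points as a product over the values of a pistol. -/
theorem sum_ite_prod_eq_pistolStep_iterate {R : Type*} [CommRing R] (t : R) (m : ℕ) :
    ∑ f : Fin m ⊕ Fin m → Fin m,
      ((∏ i, if i ≤ f (.inl i) then (1 : R) else 0) *
        (∏ i, if i ≤ f (.inr i) then (1 : R) else 0)) *
      ∏ i, ((if f (.inr i) = i then 1 else t) - (if f (.inr i) = i then 1 - t else t) *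
        ∏ r, (if r ≠ .inr i ∧ f r = i then (0 : R) else 1)) =
      (pistolStep t)^[m] (fun _ => 1) 0 := by
  rw [← sum_bool_eq_pistolStep_iterate]
  let A : (Fin m → Bool) → Fin m → Fin m → R := fun y i v => if i ≤ v ∧ y v then 1 else 0
  let B : (Fin m → Bool) → Fin m → Fin m → R := fun y i v =>
    (if v = i then (if y i then 1 else t - 1) else 0) +
      (if i < v ∧ y v then 1 else 0) * (if y i then t else -t)
  have h1 (y : Fin m → Bool) : (∏ i, ((∑ v, if i ≤ v ∧ y v then (1 : R) else 0) *
        (if y i then 1 + t * ∑ v, (if i < v ∧ y v then (1 : R) else 0)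
          else t - 1 - t * ∑ v, (if i < v ∧ y v then (1 : R) else 0)))) =
      ∑ f : Fin m ⊕ Fin m → Fin m, (∏ i, A y i (f (.inl i))) * ∏ i, B y i (f (.inr i)) := by
    have := Finset.prod_univ_sum (fun _ : Fin m ⊕ Fin m => (Finset.univ : Finset (Fin m)))
      (fun r v => Sum.elim (A y) (B y) r v)
    simp only [Fintype.prod_sum_type, Sum.elim_inl, Sum.elim_inr, Fintype.piFinset_univ] at this
    rw [← this, Finset.prod_mul_distrib]
    congr 1
    refine Finset.prod_congr rfl fun i _ => ?_
    simp only [B, Finset.sum_add_distrib, ← Finset.sum_mul, Finset.sum_ite_eq', Finset.mem_univ]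
    split_ifs <;> ring
  simp only [one_mul, h1]
  rw [Finset.sum_comm]
  refine Finset.sum_congr rfl fun f _ => ?_
  have h2 : ∏ i, ((if f (.inr i) = i then 1 else t) - (if f (.inr i) = i then 1 - t else t) *
        ∏ r, (if r ≠ .inr i ∧ f r = i then (0 : R) else 1)) =
      ∑ y : Fin m → Bool, ∏ i, ((if y i then (if f (.inr i) = i then 1 else t) else
        -(if f (.inr i) = i then 1 - t else t)) *
          ∏ r, (if ¬ y i ∧ r ≠ .inr i ∧ f r = i then (0 : R) else 1)) := by
    have := Finset.prod_univ_sum (fun _ : Fin m => (Finset.univ : Finset Bool))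
      (fun i b => ((if b then (if f (.inr i) = i then 1 else t) else
        -(if f (.inr i) = i then 1 - t else t)) *
          ∏ r, (if ¬ b ∧ r ≠ .inr i ∧ f r = i then (0 : R) else 1)))
    rw [Fintype.piFinset_univ] at this
    rw [← this]
    refine Finset.prod_congr rfl fun i _ => ?_
    simp [sub_eq_add_neg]
  rw [h2, Finset.mul_sum]
  refine Finset.sum_congr rfl fun y _ => ?_
  have h3 (r : Fin m ⊕ Fin m) : ∏ i, (if ¬ y i ∧ r ≠ .inr i ∧ f r = i then (0 : R) else 1) =
      if ¬ y (f r) ∧ r ≠ .inr (f r) then 0 else 1 := by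
    rw [Finset.prod_eq_single (f r)]
    · simp
    · intro i _ hi
      simp [hi.symm]
    · simp
  rw [Finset.prod_mul_distrib, Finset.prod_comm, Finset.prod_congr rfl fun r _ => h3 r,
    Fintype.prod_sum_type]
  simp only [← Finset.prod_mul_distrib]
  refine Finset.prod_congr rfl fun i _ => ?_
  simp only [A, B]
  have := lt_iff_le_and_ne (a := i) (b := f (.inr i))
  by_cases c : f (.inr i) = i
  · simp [c]
    grind
  · simp [c, this, Ne.symm c]
    grind

section Pistols
variable {n : ℕ}

/-- The pistol with values `2 * (f r + 1)`, where `Sum.inl i` stands for the argument `2 * i + 1`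
and `Sum.inr i` for the argument `2 * i + 2`. -/
def mkPistol (f : Fin n ⊕ Fin n → Fin n) (j : ℕ) : ℕ :=
  if h : 1 ≤ j ∧ j ≤ 2 * n then
    2 * ((f (if j % 2 = 1 then .inl ⟨(j - 1) / 2, by omega⟩ else .inr ⟨(j - 1) / 2, by omega⟩)) + 1)
  else 0

theorem mkPistol_odd (f : Fin n ⊕ Fin n → Fin n) (i : Fin n) :
    mkPistol f (2 * i + 1) = 2 * (f (.inl i) + 1) := by
  rw [mkPistol, dif_pos (by omega), if_pos (by omega)]
  congr
  omega

theorem mkPistol_even (f : Fin n ⊕ Fin n → Fin n) (i : Fin n) :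
    mkPistol f (2 * i + 2) = 2 * (f (.inr i) + 1) := by
  rw [mkPistol, dif_pos (by omega), if_neg (by omega)]
  congr
  omega

theorem exists_odd_or_even {j : ℕ} (h1 : 1 ≤ j) (h2 : j ≤ 2 * n) :
    ∃ i : Fin n, j = 2 * i + 1 ∨ j = 2 * i + 2 :=
  ⟨⟨(j - 1) / 2, by omega⟩, by simp only; omega⟩

theorem mkPistol_injective : Function.Injective (mkPistol (n := n)) := by
  intro f g h
  funext r
  rcases r with i | i
  · have := congrFun h (2 * i + 1)
    rw [mkPistol_odd, mkPistol_odd] at this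
    omega
  · have := congrFun h (2 * i + 2)
    rw [mkPistol_even, mkPistol_even] at this
    omega

/-- The condition on `f` under which `mkPistol f` is a surjective pistol. -/
def IsPistolIndex (f : Fin n ⊕ Fin n → Fin n) : Prop :=
  (∀ i, i ≤ f (.inl i)) ∧ (∀ i, i ≤ f (.inr i)) ∧ Function.Surjective f

theorem IsPistolIndex.isSP {f : Fin n ⊕ Fin n → Fin n} (hf : IsPistolIndex f) :
    IsSP n (mkPistol f) := by
  refine ⟨fun j h1 h2 => ?_, fun v hv h1 h2 => ?_, fun j hj => dif_neg (by omega)⟩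
  · obtain ⟨i, rfl | rfl⟩ := exists_odd_or_even h1 h2
    · have := Fin.le_def.1 (hf.1 i)
      rw [mkPistol_odd]
      exact ⟨by simp, by omega, by omega, by omega⟩
    · have := Fin.le_def.1 (hf.2.1 i)
      rw [mkPistol_even]
      exact ⟨by simp, by omega, by omega, by omega⟩
  · obtain ⟨k, rfl⟩ := hv
    obtain ⟨i | i, hi⟩ := hf.2.2 ⟨k - 1, by omega⟩
    · refine ⟨2 * i + 1, by omega, by omega, ?_⟩
      rw [mkPistol_odd, hi]
      simp only
      omega
    · refine ⟨2 * i + 2, by omega, by omega, ?_⟩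
      rw [mkPistol_even, hi]
      simp only
      omega

theorem exists_mkPistol_eq {F : ℕ → ℕ} (hF : IsSP n F) :
    ∃ f : Fin n ⊕ Fin n → Fin n, IsPistolIndex f ∧ mkPistol f = F := by
  obtain ⟨h1, h2, h3⟩ := hF
  have ho (i : Fin n) := h1 (2 * i + 1) (by omega) (by omega)
  have he (i : Fin n) := h1 (2 * i + 2) (by omega) (by omega)
  let f : Fin n ⊕ Fin n → Fin n := Sum.elim
    (fun i => ⟨F (2 * i + 1) / 2 - 1, by have := ho i; omega⟩)
    (fun i => ⟨F (2 * i + 2) / 2 - 1, by have := he i; omega⟩)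
  have hfo (i : Fin n) : F (2 * i + 1) = 2 * (f (.inl i) + 1) := by
    obtain ⟨⟨k, hk⟩, _⟩ := ho i
    simp only [f, Sum.elim_inl]
    omega
  have hfe (i : Fin n) : F (2 * i + 2) = 2 * (f (.inr i) + 1) := by
    obtain ⟨⟨k, hk⟩, _⟩ := he i
    simp only [f, Sum.elim_inr]
    omega
  refine ⟨f, ⟨fun i => ?_, fun i => ?_, fun v => ?_⟩, funext fun j => ?_⟩
  · have := ho i
    have := hfo i
    exact Fin.le_def.2 (by omega)
  · have := he i
    have := hfe i
    exact Fin.le_def.2 (by omega)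
  · obtain ⟨j, hj1, hj2, hj⟩ := h2 (2 * (v + 1)) (by simp) (by omega) (by omega)
    obtain ⟨i, rfl | rfl⟩ := exists_odd_or_even hj1 hj2
    · exact ⟨.inl i, Fin.ext (by have := hfo i; omega)⟩
    · exact ⟨.inr i, Fin.ext (by have := hfe i; omega)⟩
  · by_cases hj : 1 ≤ j ∧ j ≤ 2 * n
    · obtain ⟨i, rfl | rfl⟩ := exists_odd_or_even hj.1 hj.2
      · rw [mkPistol_odd, hfo]
      · rw [mkPistol_even, hfe]
    · rw [mkPistol, dif_neg hj, h3 j (by omega)]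

theorem IsPistolIndex.isDFP_iff {f : Fin n ⊕ Fin n → Fin n} (hf : IsPistolIndex f) (i : Fin n) :
    IsDFP (mkPistol f) (2 * (i + 1)) ↔ f (.inr i) = i ∧ ∃ r, r ≠ .inr i ∧ f r = i := by
  have h : mkPistol f (2 * (i + 1)) = 2 * (i + 1) ↔ f (.inr i) = i := by
    rw [mul_add, mkPistol_even, Fin.ext_iff]
    omega
  rw [IsDFP, h]
  refine and_congr_right fun _ => ⟨?_, ?_⟩
  · rintro ⟨j, hj, hji⟩
    have hj1 : 1 ≤ j := by
      by_contra hj0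
      rw [mkPistol, dif_neg (by omega)] at hji
      omega
    obtain ⟨k, rfl | rfl⟩ := exists_odd_or_even (n := n) hj1 (by omega)
    · rw [mkPistol_odd] at hji
      exact ⟨.inl k, by simp, Fin.ext (by omega)⟩
    · rw [mkPistol_even] at hji
      refine ⟨.inr k, fun hk => ?_, Fin.ext (by omega)⟩
      rw [Sum.inr_injective hk] at hj
      omega
  · rintro ⟨k | k, hk, rfl⟩
    · have := Fin.le_def.1 (hf.1 k)
      exact ⟨2 * k + 1, by omega, mkPistol_odd f k⟩
    · have h1 := Fin.le_def.1 (hf.2.1 k)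
      have h2 : (k : ℕ) ≠ f (.inr k) := fun h => hk (congrArg _ (Fin.ext h))
      exact ⟨2 * k + 2, by omega, mkPistol_even f k⟩

theorem IsPistolIndex.ndf_mkPistol (hn : 1 ≤ n) {f : Fin n ⊕ Fin n → Fin n}
    (hf : IsPistolIndex f) : ndf n (mkPistol f) =
      (Finset.univ.filter fun i => ¬ (f (.inr i) = i ∧ ∃ r, r ≠ .inr i ∧ f r = i)).card + 1 := by
  obtain ⟨m, rfl⟩ : ∃ m, n = m + 1 := ⟨n - 1, by omega⟩
  have hl : f (.inr (Fin.last m)) = Fin.last m ∧ ∃ r, r ≠ .inr (Fin.last m) ∧ f r = Fin.last m :=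
    ⟨Fin.last_le_iff.1 (hf.2.1 _), .inl (Fin.last m), by simp, Fin.last_le_iff.1 (hf.1 _)⟩
  have hset : {i : ℕ | 1 ≤ i ∧ i ≤ m + 1 ∧ ¬ (i < m + 1 ∧ IsDFP (mkPistol f) (2 * i))} =
      ((insert (Fin.last m) (Finset.univ.filter fun i =>
        ¬ (f (.inr i) = i ∧ ∃ r, r ≠ .inr i ∧ f r = i))).image fun i : Fin (m + 1) =>
          (i : ℕ) + 1) := by
    ext i
    simp only [Set.mem_ofPred_eq, Finset.coe_image, Set.mem_image, Finset.mem_coe,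
      Finset.mem_insert, Finset.mem_filter, Finset.mem_univ, true_and, ← hf.isDFP_iff]
    constructor
    · rintro ⟨h1, h2, h3⟩
      refine ⟨⟨i - 1, by omega⟩, ?_, by simp only; omega⟩
      simp only [Nat.sub_add_cancel h1]
      by_cases h : i < m + 1
      · exact .inr fun hD => h3 ⟨h, hD⟩
      · exact .inl (Fin.ext (by simp only [Fin.val_last]; omega))
    · rintro ⟨k, rfl | hk, rfl⟩
      · simp
      · exact ⟨by omega, by omega, fun h => hk h.2⟩
  rw [ndf, hset, Set.ncard_coe_finset, Finset.card_image_of_injective _ fun a b h => by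
    simpa [Fin.ext_iff] using h, Finset.card_insert_of_notMem]
  rw [Finset.mem_filter]
  exact fun h => h.2 hl

open Classical in
theorem sum_isPistolIndex_eq (hn : 1 ≤ n) :
    ∑ f : Fin n ⊕ Fin n → Fin n with IsPistolIndex f, (X : ℚ[X]) ^ ndf n (mkPistol f) =
      X * (pistolStep (X : ℚ[X]))^[n] (fun _ => 1) 0 := by
  rw [← sum_ite_prod_eq_pistolStep_iterate, Finset.mul_sum, Finset.sum_filter]
  refine Finset.sum_congr rfl fun f _ => ?_
  have hΓ (i : Fin n) : ∏ r, (if r ≠ .inr i ∧ f r = i then (0 : ℚ[X]) else 1) =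
      if ∃ r, r ≠ .inr i ∧ f r = i then 0 else 1 := by
    split_ifs with h
    · obtain ⟨r, hr⟩ := h
      exact Finset.prod_eq_zero (Finset.mem_univ r) (if_pos hr)
    · exact Finset.prod_eq_one fun r _ => if_neg fun hr => h ⟨r, hr⟩
  simp only [hΓ]
  split_ifs with hf
  · have h1 (i : Fin n) : ((if f (.inr i) = i then 1 else X) -
        (if f (.inr i) = i then 1 - X else X) *
          (if ∃ r, r ≠ .inr i ∧ f r = i then 0 else 1) : ℚ[X]) =
        if ¬ (f (.inr i) = i ∧ ∃ r, r ≠ .inr i ∧ f r = i) then X else 1 := by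
      by_cases h : f (.inr i) = i <;> by_cases h' : ∃ r, r ≠ .inr i ∧ f r = i
      · simp [h, h']
      · simp [h, h']
      · simp [h, h']
      · obtain ⟨r, hr⟩ := hf.2.2 i
        exact absurd ⟨r, fun hri => h (hri ▸ hr), hr⟩ h'
    rw [Finset.prod_congr rfl fun i _ => h1 i, hf.ndf_mkPistol hn]
    simp only [hf.1, hf.2.1, if_true, Finset.prod_const_one, Finset.prod_ite, Finset.prod_const]
    ring
  · symm
    by_cases h1 : ∀ i, i ≤ f (.inl i)
    · by_cases h2 : ∀ i, i ≤ f (.inr i)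
      · have h3 : ¬ Function.Surjective f := fun h => hf ⟨h1, h2, h⟩
        obtain ⟨i, hi⟩ := not_forall.1 h3
        rw [not_exists] at hi
        refine mul_eq_zero_of_right _ (mul_eq_zero_of_right _ ?_)
        exact Finset.prod_eq_zero (Finset.mem_univ i) (by simp [hi])
      · obtain ⟨i, hi⟩ := not_forall.1 h2
        rw [Finset.prod_eq_zero (i := i) (f := fun i => if i ≤ f (.inr i) then (1 : ℚ[X]) else 0)
          (Finset.mem_univ _) (by simp [hi])]
        simp
    · obtain ⟨i, hi⟩ := not_forall.1 h1
      rw [Finset.prod_eq_zero (i := i) (f := fun i => if i ≤ f (.inl i) then (1 : ℚ[X]) else 0)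
          (Finset.mem_univ _) (by simp [hi])]
      simp

end Pistols

section Tableaux
variable {n : ℕ}

/-- The rows of a tableau: the rows `1, …, n` from top to bottom, then the rows `n + 1, …, 2 * n`
from bottom to top. -/
def tabRow : Fin n ⊕ Fin n → ℕ :=
  Sum.elim (fun i => n - i) fun i => n + 1 + i

theorem tabRow_injective : Function.Injective (tabRow (n := n)) := by
  rintro (i | i) (j | j) h <;> simp only [tabRow, Sum.elim_inl, Sum.elim_inr] at h
  · exact congrArg _ (Fin.ext (by omega))
  · omega
  · omega
  · exact congrArg _ (Fin.ext (by omega))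

theorem tabRow_mem (r : Fin n ⊕ Fin n) : 1 ≤ tabRow r ∧ tabRow r ≤ 2 * n := by
  rcases r with i | i <;> simp only [tabRow, Sum.elim_inl, Sum.elim_inr] <;> omega

theorem exists_tabRow_eq {p : ℕ} (h1 : 1 ≤ p) (h2 : p ≤ 2 * n) :
    ∃ r : Fin n ⊕ Fin n, tabRow r = p := by
  by_cases h : p ≤ n
  · exact ⟨.inl ⟨n - p, by omega⟩, by simp only [tabRow, Sum.elim_inl]; omega⟩
  · exact ⟨.inr ⟨p - (n + 1), by omega⟩, by simp only [tabRow, Sum.elim_inr]; omega⟩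

/-- The dot in row `r` of the tableau given by `g`. -/
def tabDot (g : Fin n ⊕ Fin n → Fin n) (r : Fin n ⊕ Fin n) : ℕ × ℕ :=
  (n - g r, tabRow r)

theorem tabDot_injective (g : Fin n ⊕ Fin n → Fin n) : Function.Injective (tabDot g) :=
  fun _ _ h => tabRow_injective (congrArg Prod.snd h)

/-- The tableau whose dot in row `tabRow r` lies in column `n - g r`. -/
def mkTableau (g : Fin n ⊕ Fin n → Fin n) : Finset (ℕ × ℕ) :=
  Finset.univ.image (tabDot g)

theorem mem_mkTableau {g : Fin n ⊕ Fin n → Fin n} {d : ℕ × ℕ} :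
    d ∈ mkTableau g ↔ ∃ r, tabDot g r = d := by
  simp [mkTableau]

theorem card_filter_mkTableau (g : Fin n ⊕ Fin n → Fin n) (P : ℕ × ℕ → Prop) [DecidablePred P] :
    ((mkTableau g).filter P).card = (Finset.univ.filter fun r => P (tabDot g r)).card := by
  rw [mkTableau, Finset.filter_image, Finset.card_image_of_injective _ (tabDot_injective g)]

theorem mkTableau_injective : Function.Injective (mkTableau (n := n)) := by
  intro g g' h
  funext r
  obtain ⟨s, hs⟩ := mem_mkTableau.1 (h ▸ mem_mkTableau.2 ⟨r, rfl⟩ : tabDot g r ∈ mkTableau g')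
  obtain rfl := tabRow_injective (congrArg Prod.snd hs)
  have : n - (g' s : ℕ) = n - g s := congrArg Prod.fst hs
  exact Fin.ext (by omega)

/-- The condition on `g` under which `mkTableau g` is a tableau in `Tab n`. -/
def IsTabIndex (g : Fin n ⊕ Fin n → Fin n) : Prop :=
  (∀ i, i ≤ g (.inl i)) ∧ ∀ j, (Finset.univ.filter fun r => g r = j).card = 2

theorem isTab_mkTableau_iff (g : Fin n ⊕ Fin n → Fin n) :
    IsTab n (mkTableau g) ↔ IsTabIndex g := by
  have hcol (j : Fin n) : ((mkTableau g).filter fun d => d.1 = n - j).card =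
      (Finset.univ.filter fun r => g r = j).card := by
    rw [card_filter_mkTableau]
    refine congrArg Finset.card (Finset.filter_congr fun r _ => ?_)
    rw [tabDot, Fin.ext_iff]
    omega
  constructor
  · rintro ⟨-, -, h3, h4⟩
    refine ⟨fun i => ?_, fun j => ?_⟩
    · have : n - (g (.inl i) : ℕ) ≤ n - i := h4 _ (mem_mkTableau.2 ⟨.inl i, rfl⟩)
      exact Fin.le_def.2 (by omega)
    · rw [← hcol]
      exact h3 _ (by omega) (by omega)
  · rintro ⟨h1, h2⟩
    refine ⟨fun d hd => ?_, fun p hp1 hp2 => ?_, fun j hj1 hj2 => ?_, fun d hd => ?_⟩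
    · obtain ⟨r, rfl⟩ := mem_mkTableau.1 hd
      exact ⟨by simp only [tabDot]; omega, by simp only [tabDot]; omega, tabRow_mem r⟩
    · obtain ⟨r, rfl⟩ := exists_tabRow_eq hp1 hp2
      rw [card_filter_mkTableau, Finset.card_eq_one]
      exact ⟨r, by ext s; simp [tabDot, tabRow_injective.eq_iff]⟩
    · have := hcol ⟨n - j, by omega⟩
      rwa [h2, show n - (n - j) = j by omega] at this
    · obtain ⟨i | i, rfl⟩ := mem_mkTableau.1 hd
      · have := Fin.le_def.1 (h1 i)
        simp only [tabDot, tabRow, Sum.elim_inl]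
        omega
      · simp only [tabDot, tabRow, Sum.elim_inr]
        omega

theorem exists_mkTableau_eq {T : Finset (ℕ × ℕ)} (hT : IsTab n T) :
    ∃ g : Fin n ⊕ Fin n → Fin n, mkTableau g = T := by
  have h (r : Fin n ⊕ Fin n) : ∃ j : Fin n, T.filter (fun d => d.2 = tabRow r) =
      {(n - (j : ℕ), tabRow r)} := by
    obtain ⟨⟨c, p⟩, hd⟩ := Finset.card_eq_one.1 (hT.2.1 _ (tabRow_mem r).1 (tabRow_mem r).2)
    have hmem : (c, p) ∈ T.filter (fun d => d.2 = tabRow r) := hd ▸ Finset.mem_singleton_self _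
    rw [Finset.mem_filter] at hmem
    obtain ⟨hc, rfl⟩ := hmem
    have := hT.1 _ hc
    simp only at this
    refine ⟨⟨n - c, by omega⟩, ?_⟩
    rw [hd]
    simp only
    rw [show n - (n - c) = c by omega]
  choose g hg using h
  refine ⟨g, Finset.ext fun d => ?_⟩
  rw [mem_mkTableau]
  constructor
  · rintro ⟨r, rfl⟩
    exact (Finset.mem_filter.1 (hg r ▸ Finset.mem_singleton_self _ :
      tabDot g r ∈ T.filter (fun d => d.2 = tabRow r))).1
  · intro hd
    obtain ⟨r, hr⟩ := exists_tabRow_eq (n := n) (hT.1 d hd).2.2.1 (hT.1 d hd).2.2.2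
    have : d ∈ T.filter (fun d => d.2 = tabRow r) := Finset.mem_filter.2 ⟨hd, hr.symm⟩
    rw [hg, Finset.mem_singleton] at this
    exact ⟨r, this.symm⟩

theorem fr_mkTableau (g : Fin n ⊕ Fin n → Fin n) :
    fr n (mkTableau g) = (Finset.univ.filter fun i => g (.inr i) ≤ i).card := by
  have h : (Finset.univ.filter fun r => 2 * n + 1 ≤ (tabDot g r).1 + (tabDot g r).2) =
      (Finset.univ.filter fun i => g (.inr i) ≤ i).map .inr := by
    ext r
    rw [Finset.mem_filter, Finset.mem_map]
    rcases r with i | i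
    · simp [tabDot, tabRow]
      omega
    · simp [tabDot, tabRow]
      omega
  rw [fr, card_filter_mkTableau, h, Finset.card_map]

open Classical in
theorem sum_isTabIndex_eq :
    ∑ g : Fin n ⊕ Fin n → Fin n with IsTabIndex g, (X : ℚ[X]) ^ fr n (mkTableau g) =
      (tabStep (X : ℚ[X]))^[n] (fun k => if k = 0 then 1 else 0) 0 := by
  have h := coeff_tabProd n (X : ℚ[X]) 0 0
  rw [pow_zero, pow_zero, one_mul, mul_one] at h
  rw [← h]
  let c : Fin n ⊕ Fin n → Fin n → ℚ[X] := fun r j =>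
    Sum.elim (fun i => if i ≤ j then 1 else 0) (fun i => if j ≤ i then X else 1) r
  have h1 : tabProd (X : ℚ[X]) 0 n = ∑ g : Fin n ⊕ Fin n → Fin n,
      ∏ r, (MvPolynomial.C (c r (g r)) * MvPolynomial.X (g r)) := by
    have := Finset.prod_univ_sum (fun _ : Fin n ⊕ Fin n => (Finset.univ : Finset (Fin n)))
      (fun r j => (MvPolynomial.C (c r j) * MvPolynomial.X j : MvPolynomial (Fin n) ℚ[X]))
    rw [Fintype.piFinset_univ] at this
    rw [← this, Fintype.prod_sum_type]
    simp [tabProd, c, apply_ite, ite_mul]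
  have h2 (g : Fin n ⊕ Fin n → Fin n) :
      (∏ r, (MvPolynomial.C (c r (g r)) * MvPolynomial.X (g r)) : MvPolynomial (Fin n) ℚ[X]) =
      MvPolynomial.monomial (∑ r, Finsupp.single (g r) 1) (∏ r, c r (g r)) := by
    simp only [MvPolynomial.X, MvPolynomial.C_mul_monomial, mul_one]
    rw [MvPolynomial.monomial_sum_prod]
  have h3 (g : Fin n ⊕ Fin n → Fin n) :
      ∑ r, Finsupp.single (g r) 1 = Finsupp.equivFunOnFinite.symm (fun _ => 2) ↔
        ∀ j, (Finset.univ.filter fun r => g r = j).card = 2 := by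
    rw [Finsupp.ext_iff]
    refine forall_congr' fun j => ?_
    simp only [Finsupp.finsetSum_apply, Finsupp.single_apply, Finset.card_filter,
      Finsupp.equivFunOnFinite_symm_apply_apply]
  rw [h1, MvPolynomial.coeff_sum, Finset.sum_filter]
  refine Finset.sum_congr rfl fun g _ => ?_
  rw [h2, MvPolynomial.coeff_monomial]
  simp only [h3]
  rw [Fintype.prod_sum_type]
  simp only [c, Sum.elim_inl, Sum.elim_inr, fr_mkTableau, IsTabIndex]
  by_cases hg : ∀ i, i ≤ g (.inl i)
  · simp [hg, Finset.prod_ite]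
  · obtain ⟨i, hi⟩ := not_forall.1 hg
    rw [if_neg fun h => hg h.1, Finset.prod_eq_zero (i := i) (Finset.mem_univ _) (if_neg hi)]
    simp

end Tableaux

end GeneratingFunctions

/-- For every `n ≥ 1`, there is a surjective map `φ : Tab_n → SP_n` such that for every
`f ∈ SP_n`, `Σ_{T ∈ φ⁻¹(f)} 2^{fr(T)} = 2^{ndf(f)}`. -/
theorem exists_surjection_tab_to_sp (n : ℕ) (hn : 1 ≤ n) :
    ∃ φ : Finset (ℕ × ℕ) → (ℕ → ℕ),
      (∀ T ∈ Tab n, φ T ∈ SP n) ∧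
      (∀ f ∈ SP n, ∃ T ∈ Tab n, φ T = f) ∧
      (∀ f ∈ SP n, ∑ᶠ T ∈ {T | T ∈ Tab n ∧ φ T = f}, 2 ^ fr n T = 2 ^ ndf n f) := by
  classical
  obtain ⟨Y, hY, h⟩ := exists_pistolStep_iterate_eq n hn
  rw [← sum_isPistolIndex_eq hn, ← sum_isTabIndex_eq,
    ← Finset.sum_image (f := fun f => Polynomial.X ^ ndf n f) mkPistol_injective.injOn,
    ← Finset.sum_image (f := fun T => Polynomial.X ^ fr n T) mkTableau_injective.injOn] at h
  obtain ⟨φ, hφ, hsum⟩ := exists_grouping _ _ _ _ hY h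
  have hA (T : Finset (ℕ × ℕ)) :
      T ∈ (Finset.univ.filter IsTabIndex).image (mkTableau (n := n)) ↔ T ∈ Tab n := by
    simp only [Finset.mem_image, Finset.mem_filter, Finset.mem_univ, true_and,
      ← isTab_mkTableau_iff]
    constructor
    · rintro ⟨g, hg, rfl⟩
      exact hg
    · intro hT
      obtain ⟨g, rfl⟩ := exists_mkTableau_eq hT
      exact ⟨g, hT, rfl⟩
  have hB (f : ℕ → ℕ) :
      f ∈ (Finset.univ.filter IsPistolIndex).image (mkPistol (n := n)) ↔ f ∈ SP n := by
    simp only [Finset.mem_image, Finset.mem_filter, Finset.mem_univ, true_and]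
    constructor
    · rintro ⟨g, hg, rfl⟩
      exact hg.isSP
    · exact exists_mkPistol_eq
  simp only [hA, hB] at hφ hsum
  refine ⟨φ, hφ, fun f hf => ?_, fun f hf => ?_⟩
  · have h0 := (hsum f hf).trans_ne (pow_ne_zero _ two_ne_zero)
    obtain ⟨T, hT, -⟩ := Finset.exists_ne_zero_of_sum_ne_zero h0
    rw [Finset.mem_filter, hA] at hT
    exact ⟨T, hT⟩
  · rw [← hsum f hf, ← finsum_mem_coe_finset]
    refine finsum_mem_congr (Set.ext fun T => ?_) fun _ _ => rfl
    rw [Finset.mem_coe, Finset.mem_filter, hA]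
    rfl
end
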